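/- The Foulkes character φ^n_k of W_{r,n} decomposes into irreducibles as φ^n_k = Σ_{λ ∈ P_{r,n}} m_k(λ)·χ^λ, where the sum is over all r-multipartitions λ of n, χ^λ is the irreducible character of W_{r,n} indexed by λ, and m_k(λ) is the number of standard λ-tableaux with exactly k descents. In particular each φ^n_k is a genuine (non-virtual) character. -/

import Mathlib

/-- An `r`-multipartition of `n`: an `r`-tuple of partitions
`(λ⁽⁰⁾; …; λ⁽ʳ⁻¹⁾)` with `|λ⁽⁰⁾| + ⋯ + |λ⁽ʳ⁻¹⁾| = n`.  `part c a` is the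
length of row `a` (`0`-indexed) of the `c`-th component. -/
structure MultiPartition (r n : ℕ) where
  part : Fin r → ℕ → ℕ
  antitone : ∀ c a, part c (a + 1) ≤ part c a
  vanish : ∀ c a, n ≤ a → part c a = 0
  size : (∑ c : Fin r, ∑ a ∈ Finset.range n, part c a) = n

/-- The boxes of (the Young diagram of) an `r`-multipartition:
triples (component, row, column), `0`-indexed. -/
def MultiPartition.Box {r n : ℕ} (Λ : MultiPartition r n) : Type :=
  {x : Fin r × ℕ × ℕ // x.2.2 < Λ.part x.1 x.2.1}

/-- A standard `Λ`-tableau: a bijective filling of the boxes of `Λ` by the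
entries `1, …, n` (here `Fin n`), strictly increasing along rows and down
columns within each component. -/
structure StdTableau {r n : ℕ} (Λ : MultiPartition r n) where
  entry : Λ.Box → Fin n
  bijective : Function.Bijective entry
  row_lt : ∀ x y : Λ.Box, x.1.1 = y.1.1 → x.1.2.1 = y.1.2.1 → x.1.2.2 < y.1.2.2 →
    entry x < entry y
  col_lt : ∀ x y : Λ.Box, x.1.1 = y.1.1 → x.1.2.2 = y.1.2.2 → x.1.2.1 < y.1.2.1 →
    entry x < entry y

/-- `v ∈ {1, …, n}` is a descent of the standard tableau `T` if the entry
`v+1` lies in a strictly smaller component than `v`, or in the same component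
and a strictly larger row (with the convention that the entry `n+1` lies in
component `0`, so that the last entry `n` is a descent iff its component is
positive). -/
def StdTableau.IsDescent {r n : ℕ} {Λ : MultiPartition r n}
    (T : StdTableau Λ) (v : Fin n) : Prop :=
  if h : (v : ℕ) + 1 < n then
    ∃ x y : Λ.Box, T.entry x = v ∧ T.entry y = ⟨(v : ℕ) + 1, h⟩ ∧
      ((y.1.1 : ℕ) < (x.1.1 : ℕ) ∨ (x.1.1 = y.1.1 ∧ x.1.2.1 < y.1.2.1))
  else
    ∃ x : Λ.Box, T.entry x = v ∧ 0 < (x.1.1 : ℕ)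

/-- `v ∈ {1, …, n}` is a column-descent of the standard tableau `T` if the
entry `v+1` lies in a strictly larger component than `v`, or in the same
component and a strictly larger column (with the convention on the fictional
entry `n+1` complementary to the one for descents: the last entry `n` is a
column-descent iff its component is `0`). -/
def StdTableau.IsCDescent {r n : ℕ} {Λ : MultiPartition r n}
    (T : StdTableau Λ) (v : Fin n) : Prop :=
  if h : (v : ℕ) + 1 < n then
    ∃ x y : Λ.Box, T.entry x = v ∧ T.entry y = ⟨(v : ℕ) + 1, h⟩ ∧
      ((x.1.1 : ℕ) < (y.1.1 : ℕ) ∨ (x.1.1 = y.1.1 ∧ x.1.2.2 < y.1.2.2))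
  else
    ∃ x : Λ.Box, T.entry x = v ∧ (x.1.1 : ℕ) = 0

/-- The number of descents of a standard tableau. -/
noncomputable def StdTableau.desCount {r n : ℕ} {Λ : MultiPartition r n}
    (T : StdTableau Λ) : ℕ :=
  Nat.card {v : Fin n // T.IsDescent v}

/-- The number of column-descents of a standard tableau. -/
noncomputable def StdTableau.cdesCount {r n : ℕ} {Λ : MultiPartition r n}
    (T : StdTableau Λ) : ℕ :=
  Nat.card {v : Fin n // T.IsCDescent v}

/-- `m_k(Λ)`: the number of standard `Λ`-tableaux with exactly `k`
descents. -/
noncomputable def mCount {r n : ℕ} (Λ : MultiPartition r n) (k : ℕ) : ℕ :=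
  Nat.card {T : StdTableau Λ // T.desCount = k}

/-- `m̄_k(Λ)`: the number of standard `Λ`-tableaux with exactly `k`
column-descents. -/
noncomputable def mbarCount {r n : ℕ} (Λ : MultiPartition r n) (k : ℕ) : ℕ :=
  Nat.card {T : StdTableau Λ // T.cdesCount = k}

/-- `s_k(Λ)`: the number of row-semistandard `x_k`-tableaux of shape `Λ`:
the component `c` is filled with the variables of color `c` (there are `k+1`
variables of color `0` and `k` of every other color), weakly increasing along
rows and strictly increasing down columns. -/
noncomputable def sCount {r n : ℕ} (Λ : MultiPartition r n) (k : ℕ) : ℕ :=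
  Nat.card {e : Λ.Box → ℕ //
    (∀ x : Λ.Box, e x < if (x.1.1 : ℕ) = 0 then k + 1 else k) ∧
    (∀ x y : Λ.Box, x.1.1 = y.1.1 → x.1.2.1 = y.1.2.1 → x.1.2.2 < y.1.2.2 →
      e x ≤ e y) ∧
    (∀ x y : Λ.Box, x.1.1 = y.1.1 → x.1.2.2 = y.1.2.2 → x.1.2.1 < y.1.2.1 →
      e x < e y)}

/-- `c_k(Λ)`: the number of column-semistandard `x_k`-tableaux of shape `Λ`:
the component `c` is filled with the variables of color `c`, weakly increasing
down columns and strictly increasing along rows. -/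
noncomputable def cCount {r n : ℕ} (Λ : MultiPartition r n) (k : ℕ) : ℕ :=
  Nat.card {e : Λ.Box → ℕ //
    (∀ x : Λ.Box, e x < if (x.1.1 : ℕ) = 0 then k + 1 else k) ∧
    (∀ x y : Λ.Box, x.1.1 = y.1.1 → x.1.2.2 = y.1.2.2 → x.1.2.1 < y.1.2.1 →
      e x ≤ e y) ∧
    (∀ x y : Λ.Box, x.1.1 = y.1.1 → x.1.2.1 = y.1.2.1 → x.1.2.2 < y.1.2.2 →
      e x < e y)}

/-- The wreath product `W_{r,n} = Z_r ≀ S_n`, realized as the semidirect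
product `(Z_r)^n ⋊ S_n`, where `S_n` acts on `(Z_r)^n` by permuting the
coordinates. -/
abbrev WreathProduct (r n : ℕ) :=
  SemidirectProduct (Fin n → Multiplicative (ZMod r)) (Equiv.Perm (Fin n))
    mulAutArrow

/-- `ℓ_n(w)`: the number of color-`0` cycles of `w = (σ, x) ∈ W_{r,n}`. -/
def blockLen (r n : ℕ) (σ : Equiv.Perm (Fin n)) (x : Fin n → ZMod r) : ℕ :=
  (σ.cycleFactorsFinset.filter (fun c => (∑ i ∈ c.support, x i) = 0)).card +
    (Finset.univ.filter (fun i : Fin n => σ i = i ∧ x i = 0)).card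

/-- `ℓ_n` on the wreath product. -/
def WreathProduct.len {r n : ℕ} (w : WreathProduct r n) : ℕ :=
  blockLen r n w.right (fun i => Multiplicative.toAdd (w.left i))

/-- The Foulkes character `φ^n_k = ∑_{j=0}^{k} (-1)^j C(n+1,j) χ^n_{k-j}`
of `W_{r,n}`, where `χ^n_i(w) = (ri+1)^{ℓ_n(w)}`. -/
noncomputable def foulkesChar (r n k : ℕ) (w : WreathProduct r n) : ℂ :=
  ∑ j ∈ Finset.range (k + 1),
    (-1 : ℂ) ^ j * ((n + 1).choose j : ℂ) *
      ((r : ℂ) * (k - j : ℕ) + 1) ^ w.len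

set_option autoImplicit false

section Fomin

open scoped ENNReal Classical

/-- `m / l` is a horizontal strip -/
def HS (l m : ℕ →₀ ℕ) : Prop := ∀ i, l i ≤ m i ∧ m (i + 1) ≤ l i

/-- number of chains of horizontal strips of given sizes from the empty partition -/
noncomputable def KC : (N : ℕ) → (Fin N → ℕ) → (ℕ →₀ ℕ) → ℕ
  | 0, _, l => if l = 0 then 1 else 0
  | N + 1, a, m => ∑ l ∈ Finset.Iic m,
      if HS l m ∧ l.degree + a (Fin.last N) = m.degree then KC N (Fin.init a) l else 0

/-- indicator -/
noncomputable def ind (p : Prop) : ℝ≥0∞ := if p then 1 else 0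

theorem ind_and (p q : Prop) : ind (p ∧ q) = ind p * ind q := by
  unfold ind; by_cases hp : p <;> by_cases hq : q <;> simp [hp, hq]

theorem ind_congr {p q : Prop} (h : p ↔ q) : ind p = ind q := by rw [propext h]

theorem tsum_ind_mul {α : Type*} (p : α → Prop) (f : α → ℝ≥0∞) :
    ∑' x, ind (p x) * f x = ∑' x : {x // p x}, f x := by
  refine Eq.trans ?_ (tsum_subtype (s := {x | p x}) f).symm
  congr 1; ext x
  by_cases h : p x <;> simp [ind, h, Set.indicator]

theorem tsum_ind {α : Type*} (p : α → Prop) :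
    ∑' x, ind (p x) = ∑' _ : {x // p x}, (1 : ℝ≥0∞) := by
  have := tsum_ind_mul p (fun _ => 1)
  simpa using this

theorem tsum_ind_equiv {α β : Type*} {p : α → Prop} {q : β → Prop}
    (e : {x // p x} ≃ {y // q y}) : ∑' x, ind (p x) = ∑' y, ind (q y) := by
  rw [tsum_ind, tsum_ind]
  exact e.tsum_eq (fun _ => (1 : ℝ≥0∞))

theorem KC_succ {N : ℕ} (a : Fin (N + 1) → ℕ) (m : ℕ →₀ ℕ) :
    (KC (N + 1) a m : ℝ≥0∞) =
      ∑' l, ind (HS l m ∧ l.degree + a (Fin.last N) = m.degree) * (KC N (Fin.init a) l : ℝ≥0∞) := by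
  rw [tsum_eq_sum (s := Finset.Iic m)]
  · rw [KC]
    push_cast
    refine Finset.sum_congr rfl fun l _ => ?_
    unfold ind
    split_ifs <;> simp
  · intro l hl
    have : ¬ HS l m := fun h => hl (by
      rw [Finset.mem_Iic]; exact fun i => (h i).1)
    simp [ind, this]

theorem degree_shift (x : ℕ →₀ ℕ) :
    (Finsupp.mapDomain Nat.succ x).degree = x.degree := by
  simp [Finsupp.degree_mapDomain]

theorem degree_sup_inf (l m : ℕ →₀ ℕ) : (l ⊔ m).degree + (l ⊓ m).degree = l.degree + m.degree := by
  rw [← map_add, ← map_add]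
  congr 1
  ext i
  simp [max_add_min]

/-- local RSK forward map -/
noncomputable def fwd (l m : ℕ →₀ ℕ) (j : ℕ) (k : ℕ →₀ ℕ) : ℕ →₀ ℕ :=
  Finsupp.single 0 j + (l ⊔ m) + Finsupp.mapDomain Nat.succ (l ⊓ m - k)

theorem fwd_zero (l m : ℕ →₀ ℕ) (j : ℕ) (k : ℕ →₀ ℕ) : fwd l m j k 0 = j + max (l 0) (m 0) := by
  simp [fwd]
  rw [Finsupp.mapDomain_of_notMem_range]
  simp

theorem fwd_succ (l m : ℕ →₀ ℕ) (j : ℕ) (k : ℕ →₀ ℕ) (i : ℕ) : fwd l m j k (i + 1) =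
    max (l (i + 1)) (m (i + 1)) + (min (l i) (m i) - k i) := by
  have : Finsupp.mapDomain Nat.succ (l ⊓ m - k) (i + 1) = (l ⊓ m - k) i :=
    Finsupp.mapDomain_apply Nat.succ_injective _ i
  simp [fwd, this]

theorem fwd_degree (l m : ℕ →₀ ℕ) (j : ℕ) (k : ℕ →₀ ℕ) (h1 : HS k l) (h2 : HS k m) :
    (fwd l m j k).degree + k.degree = j + l.degree + m.degree := by
  have hk : k ≤ l ⊓ m := fun i => le_min (h1 i).1 (h2 i).1
  have h3 : (l ⊓ m - k).degree + k.degree = (l ⊓ m).degree := by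
    rw [← map_add, tsub_add_cancel_of_le hk]
  have h4 := degree_sup_inf l m
  simp only [fwd, map_add, degree_shift, Finsupp.degree_single]
  omega

/-- local RSK backward map -/
noncomputable def bwd (l m v : ℕ →₀ ℕ) : ℕ →₀ ℕ :=
  l ⊓ m - Finsupp.comapDomain Nat.succ (v - l ⊔ m) (Nat.succ_injective.injOn)

theorem bwd_apply (l m v : ℕ →₀ ℕ) (i : ℕ) : bwd l m v i =
    min (l i) (m i) - (v (i + 1) - max (l (i + 1)) (m (i + 1))) := by
  simp [bwd]

theorem local_rule (l m : ℕ →₀ ℕ) (a b : ℕ) :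
    ∑' v : ℕ →₀ ℕ, ind ((HS l v ∧ l.degree + a = v.degree) ∧ (HS m v ∧ m.degree + b = v.degree)) =
    ∑' x : ℕ × (ℕ →₀ ℕ), ind ((x.1 ≤ b ∧ x.1 ≤ a) ∧ (HS x.2 l ∧ x.2.degree + (b - x.1) = l.degree) ∧
      (HS x.2 m ∧ x.2.degree + (a - x.1) = m.degree)) := by
  have hs : ∀ v, HS l v → HS m v → fwd l m (v 0 - max (l 0) (m 0)) (bwd l m v) = v ∧
      HS (bwd l m v) l ∧ HS (bwd l m v) m := by
    intro v h1 h2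
    refine ⟨?_, ?_, ?_⟩
    · ext i
      rcases i with _ | i
      · rw [fwd_zero]
        have := (h1 0).1; have := (h2 0).1
        omega
      · rw [fwd_succ, bwd_apply]
        have := h1 (i + 1); have := h2 (i + 1); have := h1 i; have := h2 i
        omega
    · intro i
      rw [bwd_apply]
      have := h1 (i + 1); have := h2 (i + 1); have := h1 i; have := h2 i
      omega
    · intro i
      rw [bwd_apply]
      have := h1 (i + 1); have := h2 (i + 1); have := h1 i; have := h2 i
      omega
  have hf : ∀ j k, HS k l → HS k m → HS l (fwd l m j k) ∧ HS m (fwd l m j k) := by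
    intro j k h1 h2
    constructor <;> intro i <;> have := h1 i <;> have := h2 i <;> refine ⟨?_, ?_⟩
    · rcases i with _ | i
      · rw [fwd_zero]; omega
      · rw [fwd_succ]; omega
    · rw [fwd_succ]; omega
    · rcases i with _ | i
      · rw [fwd_zero]; omega
      · rw [fwd_succ]; omega
    · rw [fwd_succ]; omega
  refine (tsum_ind_equiv ?_).symm
  refine
    { toFun := fun x => ⟨fwd l m x.1.1 x.1.2, ?_⟩
      invFun := fun v => ⟨(v.1 0 - max (l 0) (m 0), bwd l m v.1), ?_⟩
      left_inv := ?_
      right_inv := ?_ }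
  · obtain ⟨⟨j, k⟩, ⟨hj1, hj2⟩, ⟨h1, e1⟩, h2, e2⟩ := x
    have := fwd_degree l m j k h1 h2
    have e1' : k.degree + (b - j) = l.degree := e1
    have e2' : k.degree + (a - j) = m.degree := e2
    have hj1' : j ≤ b := hj1
    have hj2' : j ≤ a := hj2
    have h1' : HS k l := h1
    have h2' : HS k m := h2
    have := hf j k h1 h2
    show (HS l (fwd l m j k) ∧ l.degree + a = (fwd l m j k).degree) ∧
      (HS m (fwd l m j k) ∧ m.degree + b = (fwd l m j k).degree)
    exact ⟨⟨this.1, by omega⟩, this.2, by omega⟩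
  · obtain ⟨v, ⟨h1, e1⟩, h2, e2⟩ := v
    obtain ⟨e, h3, h4⟩ := hs v h1 h2
    have hd := fwd_degree l m (v 0 - max (l 0) (m 0)) (bwd l m v) h3 h4
    rw [e] at hd
    have g1 : (bwd l m v).degree ≤ l.degree := Finsupp.degree_mono (fun i => (h3 i).1)
    have g2 : (bwd l m v).degree ≤ m.degree := Finsupp.degree_mono (fun i => (h4 i).1)
    simp only at *
    exact ⟨⟨by omega, by omega⟩, ⟨h3, by omega⟩, h4, by omega⟩
  · rintro ⟨⟨j, k⟩, ⟨hj1, hj2⟩, ⟨h1, e1⟩, h2, e2⟩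
    have e1' : k.degree + (b - j) = l.degree := e1
    have e2' : k.degree + (a - j) = m.degree := e2
    have hj1' : j ≤ b := hj1
    have hj2' : j ≤ a := hj2
    have h1' : HS k l := h1
    have h2' : HS k m := h2
    apply Subtype.ext
    apply Prod.ext
    · simp [fwd_zero]
    · ext i
      simp only [bwd_apply, fwd_succ]
      have := h1' i; have := h2' i
      omega
  · rintro ⟨v, ⟨h1, e1⟩, h2, e2⟩
    exact Subtype.ext (hs v h1 h2).1

theorem up_rule (N : ℕ) : ∀ (a : Fin N → ℕ) (b : ℕ) (m : ℕ →₀ ℕ),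
    ∑' v, ind (HS m v ∧ m.degree + b = v.degree) * (KC N a v : ℝ≥0∞) =
    ∑' j : Fin N → ℕ, ind (j ≤ a ∧ ∑ i, j i = b) * (KC N (a - j) m : ℝ≥0∞) := by
  induction N with
  | zero =>
    intro a b m
    rw [tsum_eq_single 0]
    · rw [tsum_eq_single default (fun x hx => absurd (Subsingleton.elim _ _) hx)]
      by_cases hm : m = 0
      · subst hm
        have h0 : HS (0 : ℕ →₀ ℕ) 0 := fun i => by simp
        simp [KC, h0, Subsingleton.elim default a, eq_comm]
      · have : ¬ HS m 0 := fun h => hm (by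
          ext i; simpa using (h i).1)
        simp [ind, this, KC, hm]
    · intro v hv
      simp [KC, hv]
  | succ N ih =>
    intro a b m
    simp_rw [KC_succ a, ← ENNReal.tsum_mul_left]
    rw [ENNReal.tsum_comm]
    calc _ = ∑' l, (∑' v : ℕ →₀ ℕ, ind ((HS l v ∧ l.degree + a (Fin.last N) = v.degree) ∧
              (HS m v ∧ m.degree + b = v.degree))) * (KC N (Fin.init a) l : ℝ≥0∞) := by
            refine tsum_congr fun l => ?_
            rw [← ENNReal.tsum_mul_right]
            refine tsum_congr fun v => ?_
            rw [ind_and (HS l v ∧ _)]; ring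
      _ = ∑' l, (∑' x : ℕ × (ℕ →₀ ℕ), ind (x.1 ≤ b ∧ x.1 ≤ a (Fin.last N)) *
            (ind (HS x.2 l ∧ x.2.degree + (b - x.1) = l.degree) *
            ind (HS x.2 m ∧ x.2.degree + (a (Fin.last N) - x.1) = m.degree)))
             * (KC N (Fin.init a) l : ℝ≥0∞) := by
            refine tsum_congr fun l => ?_
            rw [local_rule]
            simp_rw [ind_and (_ ∧ _) ((_ ∧ _) ∧ _), ind_and (HS _ l ∧ _)]
      _ = ∑' x : ℕ × (ℕ →₀ ℕ), ind (x.1 ≤ b ∧ x.1 ≤ a (Fin.last N)) *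
            ind (HS x.2 m ∧ x.2.degree + (a (Fin.last N) - x.1) = m.degree) *
            ∑' l, ind (HS x.2 l ∧ x.2.degree + (b - x.1) = l.degree) * (KC N (Fin.init a) l : ℝ≥0∞) := by
            simp_rw [← ENNReal.tsum_mul_right, ← ENNReal.tsum_mul_left]
            rw [ENNReal.tsum_comm]
            refine tsum_congr fun x => tsum_congr fun l => ?_
            ring
      _ = ∑' j : ℕ, ∑' j' : Fin N → ℕ, ∑' k, ind (j ≤ b ∧ j ≤ a (Fin.last N)) *
            ind (HS k m ∧ k.degree + (a (Fin.last N) - j) = m.degree) *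
            (ind (j' ≤ Fin.init a ∧ ∑ i, j' i = b - j) * (KC N (Fin.init a - j') k : ℝ≥0∞)) := by
            simp_rw [ih]
            rw [ENNReal.tsum_prod']
            refine tsum_congr fun j => ?_
            simp_rw [← ENNReal.tsum_mul_left]
            rw [ENNReal.tsum_comm]
      _ = _ := by
            rw [← (Fin.snocEquiv (fun _ : Fin (N + 1) => ℕ)).tsum_eq, ENNReal.tsum_prod']
            refine tsum_congr fun j => tsum_congr fun j' => ?_
            rw [KC_succ, ← ENNReal.tsum_mul_left]
            refine tsum_congr fun k => ?_
            have e1 : (a - (Fin.snocEquiv (fun _ : Fin (N + 1) => ℕ)) (j, j')) (Fin.last N)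
                = a (Fin.last N) - j := by simp [Fin.snocEquiv]
            have e2 : Fin.init (a - (Fin.snocEquiv (fun _ : Fin (N + 1) => ℕ)) (j, j'))
                = Fin.init a - j' := by ext i; simp [Fin.snocEquiv, Fin.init]
            rw [e1, e2]
            have e3 : ((Fin.snocEquiv (fun _ : Fin (N + 1) => ℕ)) (j, j') ≤ a ∧
              ∑ i, (Fin.snocEquiv (fun _ : Fin (N + 1) => ℕ)) (j, j') i = b) ↔
              (j ≤ b ∧ j ≤ a (Fin.last N)) ∧ (j' ≤ Fin.init a ∧ ∑ i, j' i = b - j) := by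
              rw [Fin.sum_univ_castSucc, Pi.le_def, Fin.forall_fin_succ']
              simp only [Fin.snocEquiv, Equiv.coe_fn_mk, Fin.snoc_castSucc, Fin.snoc_last, Pi.le_def,
                Fin.init]
              constructor
              · rintro ⟨⟨h1, h2⟩, h3⟩
                exact ⟨⟨by omega, h2⟩, h1, by omega⟩
              · rintro ⟨⟨h1, h2⟩, h3, h4⟩
                exact ⟨⟨h3, h2⟩, by omega⟩
            rw [ind_congr e3, ind_and (j ≤ b ∧ _)]
            ring

theorem KC_zero {N : ℕ} (a : Fin N → ℕ) : KC N a 0 = if a = 0 then 1 else 0 := by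
  induction N with
  | zero => simp [KC, Subsingleton.elim a 0]
  | succ N ih =>
    have : Finset.Iic (0 : ℕ →₀ ℕ) = {0} := by
      ext x; rw [Finset.mem_Iic]; simp
    have h0 : HS (0 : ℕ →₀ ℕ) 0 := fun i => by simp
    rw [KC, this, Finset.sum_singleton, ih]
    have e : a = 0 ↔ a (Fin.last N) = 0 ∧ Fin.init a = 0 := by
      rw [funext_iff, Fin.forall_fin_succ', funext_iff, and_comm]
      rfl
    simp only [h0, true_and, map_zero, zero_add, ← ite_and, e]

/-- number of matrices with given margins -/
noncomputable def matc {N N' : ℕ} (a : Fin N → ℕ) (b : Fin N' → ℕ) : ℝ≥0∞ :=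
  ∑' g : Fin N' → Fin N → ℕ, ind ((∀ i, ∑ j, g j i = a i) ∧ (∀ j, ∑ i, g j i = b j))

theorem fomin {N : ℕ} (N' : ℕ) : ∀ (a : Fin N → ℕ) (b : Fin N' → ℕ),
    ∑' l, (KC N a l : ℝ≥0∞) * (KC N' b l : ℝ≥0∞) = matc a b := by
  induction N' with
  | zero =>
    intro a b
    rw [tsum_eq_single 0 (by intro l hl; simp [KC, hl]), matc,
      tsum_eq_single default (fun x hx => absurd (Subsingleton.elim _ _) hx), KC_zero]
    simp [KC, ind, funext_iff, eq_comm]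
  | succ N' ih =>
    intro a b
    simp_rw [KC_succ b, ← ENNReal.tsum_mul_left]
    rw [ENNReal.tsum_comm]
    calc _ = ∑' k, (KC N' (Fin.init b) k : ℝ≥0∞) *
            ∑' v, ind (HS k v ∧ k.degree + b (Fin.last N') = v.degree) * (KC N a v : ℝ≥0∞) := by
            refine tsum_congr fun k => ?_
            rw [← ENNReal.tsum_mul_left]
            refine tsum_congr fun v => ?_
            ring
      _ = ∑' j : Fin N → ℕ, ind (j ≤ a ∧ ∑ i, j i = b (Fin.last N')) *
            matc (a - j) (Fin.init b) := by
            simp_rw [up_rule, ← ih, ← ENNReal.tsum_mul_left]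
            rw [ENNReal.tsum_comm]
            refine tsum_congr fun j => tsum_congr fun k => ?_
            ring
      _ = _ := by
            rw [matc, ← (Fin.snocEquiv (fun _ : Fin (N' + 1) => Fin N → ℕ)).tsum_eq,
              ENNReal.tsum_prod']
            refine tsum_congr fun j => ?_
            rw [matc, ← ENNReal.tsum_mul_left]
            refine tsum_congr fun g => ?_
            rw [← ind_and]
            refine ind_congr ?_
            simp only [Fin.sum_univ_castSucc, Fin.forall_fin_succ', Fin.snocEquiv, Equiv.coe_fn_mk,
              Fin.snoc_castSucc, Fin.snoc_last, Pi.le_def, Fin.init, Pi.sub_apply]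
            constructor
            · rintro ⟨⟨h1, h2⟩, h3, h4⟩
              refine ⟨fun i => ?_, h4, h2⟩
              have := h1 i; have := h3 i; omega
            · rintro ⟨h1, h2, h3⟩
              refine ⟨⟨fun i => ?_, h3⟩, fun i => ?_, h2⟩ <;> have := h1 i <;> omega

end Fomin

set_option autoImplicit false

section KCFacts

open scoped ENNReal Classical

theorem KC_ex {N : ℕ} {a : Fin (N + 1) → ℕ} {m : ℕ →₀ ℕ} (h : KC (N + 1) a m ≠ 0) :
    ∃ l, HS l m ∧ l.degree + a (Fin.last N) = m.degree ∧ KC N (Fin.init a) l ≠ 0 := by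
  rw [KC] at h
  obtain ⟨l, _, hl⟩ := Finset.exists_ne_zero_of_sum_ne_zero h
  by_cases hc : HS l m ∧ l.degree + a (Fin.last N) = m.degree
  · rw [if_pos hc] at hl
    exact ⟨l, hc.1, hc.2, hl⟩
  · rw [if_neg hc] at hl; exact absurd rfl hl

theorem KC_degree {N : ℕ} : ∀ {a : Fin N → ℕ} {m : ℕ →₀ ℕ}, KC N a m ≠ 0 →
    m.degree = ∑ i, a i := by
  induction N with
  | zero => intro a m h; simp [KC] at h; simp [h]
  | succ N ih =>
    intro a m h
    obtain ⟨l, _, h2, h3⟩ := KC_ex h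
    rw [Fin.sum_univ_castSucc, ← h2, ih h3]; rfl

theorem KC_vanish {N : ℕ} : ∀ {a : Fin N → ℕ} {m : ℕ →₀ ℕ}, KC N a m ≠ 0 →
    ∀ i, N ≤ i → m i = 0 := by
  induction N with
  | zero => intro a m h; simp [KC] at h; simp [h]
  | succ N ih =>
    intro a m h i hi
    obtain ⟨l, h1, h2, h3⟩ := KC_ex h
    obtain ⟨i, rfl⟩ : ∃ j, i = j + 1 := ⟨i - 1, by omega⟩
    have := (h1 i).2
    rw [ih h3 i (by omega)] at this
    omega

theorem KC_antitone {N : ℕ} {a : Fin N → ℕ} {m : ℕ →₀ ℕ} (h : KC N a m ≠ 0) :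
    ∀ i, m (i + 1) ≤ m i := by
  cases N with
  | zero => simp [KC] at h; simp [h]
  | succ N =>
    intro i
    obtain ⟨l, h1, h2, h3⟩ := KC_ex h
    exact (h1 i).2.trans (h1 i).1

theorem degree_eq_range {N : ℕ} {m : ℕ →₀ ℕ} (h : ∀ i, N ≤ i → m i = 0) :
    m.degree = ∑ i ∈ Finset.range N, m i := by
  rw [Finsupp.degree_apply]
  refine Finset.sum_subset (fun i hi => ?_) (fun i _ hi => by simpa using hi)
  rw [Finset.mem_range]
  by_contra hc
  exact (Finsupp.mem_support_iff.1 hi) (h i (by omega))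

theorem KC_dom {N : ℕ} (A : ℕ → ℕ) : ∀ {m : ℕ →₀ ℕ}, KC N (fun i => A i) m ≠ 0 →
    ∀ j, j ≤ N → ∑ i ∈ Finset.range j, A i ≤ ∑ i ∈ Finset.range j, m i := by
  induction N with
  | zero => intro m h j hj; simp [show j = 0 by omega]
  | succ N ih =>
    intro m h j hj
    obtain ⟨l, h1, h2, h3⟩ := KC_ex h
    rcases Nat.lt_or_ge j (N + 1) with hj' | hj'
    · refine (ih h3 j (by omega)).trans (Finset.sum_le_sum fun i _ => (h1 i).1)
    · have : j = N + 1 := by omega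
      subst this
      rw [← degree_eq_range (KC_vanish h), KC_degree h, Finset.sum_range]

theorem KC_diag {N : ℕ} : ∀ {m : ℕ →₀ ℕ}, (∀ i, m (i + 1) ≤ m i) → (∀ i, N ≤ i → m i = 0) →
    KC N (fun i => m i) m = 1 := by
  induction N with
  | zero =>
    intro m _ h; rw [KC, if_pos]; ext i; exact h i (by omega)
  | succ N ih =>
    intro m h1 h2
    have e1 : ∀ i, i ≠ N → m.erase N i = m i := fun i hi => Finsupp.erase_ne hi
    have e2 : m.erase N N = 0 := Finsupp.erase_same
    have hv : ∀ i, N ≤ i → m.erase N i = 0 := by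
      intro i hi
      rcases Nat.eq_or_lt_of_le hi with h | h
      · rw [← h, e2]
      · rw [e1 i (by omega), h2 i (by omega)]
    have hsm : ∑ i ∈ Finset.range N, m.erase N i = ∑ i ∈ Finset.range N, m i :=
      Finset.sum_congr rfl fun i hi => e1 i (by rw [Finset.mem_range] at hi; omega)
    have hdeg : (m.erase N).degree + m N = m.degree := by
      rw [degree_eq_range h2, degree_eq_range hv, Finset.sum_range_succ, hsm]
    have hfun : (Fin.init (fun i : Fin (N + 1) => m i)) = fun i : Fin N => m.erase N i := by
      funext i
      rw [e1 i (by omega)]; rfl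
    have hH : HS (m.erase N) m := by
      intro i
      by_cases hi : i = N
      · subst hi; rw [e2, h2 (i + 1) (by omega)]; simp
      · rw [e1 i hi]; exact ⟨le_rfl, h1 i⟩
    rw [KC, Finset.sum_eq_single (m.erase N)]
    · rw [if_pos ⟨hH, by simpa using hdeg⟩, hfun]
      refine ih (fun i => ?_) hv
      by_cases hi : N ≤ i + 1
      · rw [hv _ hi]; omega
      · rw [e1 _ (by omega), e1 _ (by omega)]; exact h1 i
    · intro l _ hl
      by_contra hc
      by_cases hcc : HS l m ∧ l.degree + m (Fin.last N) = m.degree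
      · rw [if_pos hcc] at hc
        apply hl
        have hvl := KC_vanish hc
        have : ∑ i ∈ Finset.range N, l i = ∑ i ∈ Finset.range N, m.erase N i := by
          have h3 := hcc.2
          rw [Fin.val_last] at h3
          rw [← degree_eq_range hvl, ← degree_eq_range hv]; omega
        rw [hsm] at this
        have h4 := (Finset.sum_eq_sum_iff_of_le (fun i _ => (hcc.1 i).1)).1 this
        ext i
        rcases Nat.lt_or_ge i N with hi | hi
        · rw [h4 i (Finset.mem_range.2 hi), e1 i (by omega)]
        · rw [hvl i hi, hv i hi]
      · rw [if_neg hcc] at hc; exact hc rfl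
    · intro h
      exact absurd (Finset.mem_Iic.2 (fun i => (hH i).1)) h

end KCFacts

set_option autoImplicit false

section SSYT

open scoped ENNReal Classical

/-- semistandard tableaux of shape `l` with entries `< N`, extended by `N` outside of the shape -/
def SS (N : ℕ) (l : ℕ →₀ ℕ) (e : ℕ → ℕ → ℕ) : Prop :=
  (∀ i j, e i j < N ↔ j < l i) ∧ (∀ i j, e i j ≤ N) ∧ (∀ i j, e i j ≤ e i (j + 1)) ∧
  (∀ i i' j, i < i' → e i' j < N → e i j < e i' j)

theorem ss_fwd {N : ℕ} {l m : ℕ →₀ ℕ} {e : ℕ → ℕ → ℕ} (h : HS l m) (hs : SS N l e) :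
    SS (N + 1) m (fun i j => if j < m i then e i j else N + 1) := by
  obtain ⟨h1, h2, h3, h4⟩ := hs
  have hanti : Antitone m := antitone_nat_of_succ_le fun i => (h i).2.trans (h i).1
  refine ⟨fun i j => ?_, fun i j => ?_, fun i j => ?_, fun i i' j hi hj => ?_⟩
  · have := h2 i j
    dsimp only; split_ifs <;> simp_all
  · have := h2 i j
    dsimp only; split_ifs <;> omega
  · have := h2 i j
    have := h3 i j
    dsimp only; split_ifs <;> omega
  · dsimp only at hj ⊢
    by_cases hjm : j < m i'
    · have hjm' : j < m i := lt_of_lt_of_le hjm (hanti hi.le)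
      rw [if_pos hjm] at hj ⊢
      rw [if_pos hjm']
      rcases Nat.lt_or_ge (e i' j) N with hc | hc
      · exact h4 i i' j hi hc
      · have : e i j < N := (h1 i j).2 (lt_of_lt_of_le hjm ((hanti hi).trans (h i).2))
        omega
    · rw [if_neg hjm] at hj; omega

theorem ss_bwd {N : ℕ} {m : ℕ →₀ ℕ} {e : ℕ → ℕ → ℕ} (hs : SS (N + 1) m e) :
    ∃ l, HS l m ∧ SS N l (fun i j => min (e i j) N) := by
  obtain ⟨h1, h2, h3, h4⟩ := hs
  have hmono : ∀ i, Monotone (e i) := fun i => monotone_nat_of_le_succ (h3 i)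
  have hex : ∀ i, ∃ L, ∀ j, e i j < N ↔ j < L := by
    intro i
    have hx : ∃ j, N ≤ e i j := ⟨m i, by have := h1 i (m i); omega⟩
    refine ⟨Nat.find hx, fun j => ⟨fun h => ?_, fun h => ?_⟩⟩
    · by_contra hc
      have := hmono i (not_lt.1 hc)
      have := Nat.find_spec hx
      omega
    · have := Nat.find_min hx h
      omega
  choose L hL using hex
  have hLm : ∀ i, L i ≤ m i := by
    intro i
    by_contra hc
    have h5 := (hL i (m i)).2 (by omega)
    have h6 := (h1 i (m i)).1 (by omega)
    omega
  refine ⟨Finsupp.onFinset m.support L (fun i hi => ?_), fun i => ⟨hLm i, ?_⟩, ?_, ?_, ?_, ?_⟩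
  · rw [Finsupp.mem_support_iff]; have := hLm i; omega
  · by_contra hc
    rw [Finsupp.onFinset_apply] at hc
    have h5 := (h1 (i + 1) (L i)).2 (by omega)
    have h6 := h4 i (i + 1) (L i) (by omega) h5
    have := (hL i (L i)).1 (by omega)
    omega
  · intro i j
    rw [Finsupp.onFinset_apply, ← hL]; simp
  · intro i j; simp
  · intro i j; exact min_le_min_right _ (h3 i j)
  · intro i i' j hi hj
    have := h4 i i' j hi
    dsimp only at *
    omega

theorem ss_count {N : ℕ} : ∀ (m : ℕ →₀ ℕ),
    ∑' a : Fin N → ℕ, (KC N a m : ℝ≥0∞) = ∑' e, ind (SS N m e) := by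
  induction N with
  | zero =>
    intro m
    rw [tsum_eq_single (0 : Fin 0 → ℕ) (fun b hb => absurd (Subsingleton.elim b 0) hb),
      tsum_eq_single (0 : ℕ → ℕ → ℕ)]
    · rw [KC, ind]
      by_cases hm : m = 0
      · rw [if_pos hm, if_pos]; simp
        subst hm
        exact ⟨by simp, by simp, by simp, by simp⟩
      · rw [if_neg hm, if_neg]; simp
        intro h
        apply hm
        ext i
        have := (h.1 i 0)
        simp at this
        simpa using this
    · intro e he
      rw [ind, if_neg]
      intro h
      apply he
      funext i j
      have := h.2.1 i j
      simpa using this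
  | succ N ih =>
    intro m
    calc ∑' a : Fin (N + 1) → ℕ, (KC (N + 1) a m : ℝ≥0∞)
        = ∑' (p : ℕ × (Fin N → ℕ)), (KC (N + 1) (Fin.snoc p.2 p.1 : Fin (N + 1) → ℕ) m : ℝ≥0∞) := by
          rw [← (Fin.snocEquiv (fun _ : Fin (N + 1) => ℕ)).tsum_eq]; rfl
      _ = ∑' (x : ℕ), ∑' (a : Fin N → ℕ), ∑' l, ind (HS l m) * ind (l.degree + x = m.degree) *
            (KC N a l : ℝ≥0∞) := by
          rw [ENNReal.tsum_prod']
          refine tsum_congr fun x => tsum_congr fun a => ?_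
          rw [KC_succ]
          refine tsum_congr fun l => ?_
          rw [ind_and, Fin.snoc_last, Fin.init_snoc]
      _ = ∑' l, ind (HS l m) * ∑' (a : Fin N → ℕ), (KC N a l : ℝ≥0∞) := by
          have : ∀ x : ℕ, ∑' (a : Fin N → ℕ), ∑' l, ind (HS l m) * ind (l.degree + x = m.degree) *
            (KC N a l : ℝ≥0∞) = ∑' l, ind (HS l m) * ind (l.degree + x = m.degree) * ∑' (a : Fin N → ℕ),
            (KC N a l : ℝ≥0∞) := by
            intro x
            rw [ENNReal.tsum_comm]
            exact tsum_congr fun l => ENNReal.tsum_mul_left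
          simp_rw [this]
          rw [ENNReal.tsum_comm]
          refine tsum_congr fun l => ?_
          rw [ENNReal.tsum_mul_right, ENNReal.tsum_mul_left]
          by_cases h : HS l m
          · congr 1
            have hd : l.degree ≤ m.degree := by
              have : l ≤ m := fun i => (h i).1
              obtain ⟨d, rfl⟩ := exists_add_of_le this
              simp
            rw [tsum_eq_single (m.degree - l.degree)]
            · rw [ind, ind, if_pos h, if_pos (by omega)]; simp
            · intro x hx
              rw [ind, if_neg (by omega)]
          · simp [ind, h]
      _ = ∑' (p : (ℕ →₀ ℕ) × (ℕ → ℕ → ℕ)), ind (HS p.1 m ∧ SS N p.1 p.2) := by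
          rw [ENNReal.tsum_prod']
          refine tsum_congr fun l => ?_
          rw [ih, ← ENNReal.tsum_mul_left]
          exact tsum_congr fun e => (ind_and _ _).symm
      _ = ∑' e, ind (SS (N + 1) m e) := by
          refine tsum_ind_equiv (Equiv.ofBijective
            (fun p => ⟨fun i j => if j < m i then p.1.2 i j else N + 1, ss_fwd p.2.1 p.2.2⟩) ⟨?_, ?_⟩)
          · rintro ⟨⟨l, e⟩, h1, h2⟩ ⟨⟨l', e'⟩, h1', h2'⟩ h
            have h := congrArg Subtype.val h
            dsimp only at h
            replace h1 : HS l m := h1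
            replace h1' : HS l' m := h1'
            replace h2 : SS N l e := h2
            replace h2' : SS N l' e' := h2'
            have he : e = e' := by
              funext i j
              have := congrFun (congrFun h i) j
              by_cases hj : j < m i
              · simpa [hj] using this
              · have a1 := h2.1 i j
                have a2 := h2.2.1 i j
                have a3 := h2'.1 i j
                have a4 := h2'.2.1 i j
                have := (h1 i).1
                have := (h1' i).1
                omega
            subst he
            have : l = l' := by
              ext i
              have h3 := fun j => (h2.1 i j).symm.trans (h2'.1 i j)
              have := h3 (l i)
              have := h3 (l' i)
              omega
            subst this
            rfl
          · rintro ⟨e, he⟩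
            obtain ⟨l, hl, hs⟩ := ss_bwd he
            refine ⟨⟨(l, _), hl, hs⟩, ?_⟩
            apply Subtype.ext
            funext i j
            dsimp only
            have a1 := he.1 i j
            have a2 := he.2.1 i j
            split_ifs <;> omega

theorem ss_card {N n : ℕ} (m : ℕ →₀ ℕ) (hm : m.degree ≤ n) :
    Nat.card {e // SS N m e} =
      ∑ a ∈ Fintype.piFinset (fun _ : Fin N => Finset.range (n + 1)), KC N a m := by
  have h := ss_count (N := N) m
  rw [tsum_ind, ENNReal.tsum_const, tsum_eq_sum
    (s := Fintype.piFinset (fun _ : Fin N => Finset.range (n + 1)))] at h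
  · rw [Nat.card]
    rw [mul_one, ← Nat.cast_sum] at h
    have h2 : ENat.card {e // SS N m e} = 
      ((∑ a ∈ Fintype.piFinset (fun _ : Fin N => Finset.range (n + 1)), KC N a m : ℕ) : ℕ∞) := by
      apply ENat.toENNReal_inj.1
      rw [← h]; rfl
    change (ENat.card {e // SS N m e}).toNat = _
    rw [h2]; exact ENat.toNat_natCast _
  · intro a ha
    rw [Nat.cast_eq_zero]
    by_contra hc
    apply ha
    rw [Fintype.mem_piFinset]
    intro i
    have := KC_degree hc
    have := Finset.single_le_sum (f := a) (fun i _ => Nat.zero_le _) (Finset.mem_univ i)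
    rw [Finset.mem_range]
    omega

end SSYT

set_option autoImplicit false

section MP

open scoped Classical

variable {r n : ℕ}

theorem MultiPartition.ext' {Λ Λ' : MultiPartition r n} (h : ∀ c a, Λ.part c a = Λ'.part c a) :
    Λ = Λ' := by
  cases Λ; cases Λ'; congr; funext c a; exact h c a

/-- component as finsupp -/
noncomputable def MultiPartition.fs (Λ : MultiPartition r n) (c : Fin r) : ℕ →₀ ℕ :=
  Finsupp.onFinset (Finset.range n) (Λ.part c) (fun a ha => by
    rw [Finset.mem_range]; by_contra hc; exact ha (Λ.vanish c a (by omega)))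

theorem MultiPartition.fs_apply (Λ : MultiPartition r n) (c : Fin r) (i : ℕ) :
    Λ.fs c i = Λ.part c i := rfl

theorem MultiPartition.fs_degree (Λ : MultiPartition r n) (c : Fin r) :
    (Λ.fs c).degree = ∑ i ∈ Finset.range n, Λ.part c i :=
  degree_eq_range (m := Λ.fs c) (Λ.vanish c)

theorem MultiPartition.sum_degree (Λ : MultiPartition r n) :
    ∑ c, (Λ.fs c).degree = n := by
  simp_rw [Λ.fs_degree]; exact Λ.size

theorem MultiPartition.degree_le (Λ : MultiPartition r n) (c : Fin r) :
    (Λ.fs c).degree ≤ n := by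
  conv_rhs => rw [← Λ.sum_degree]
  exact Finset.single_le_sum (f := fun c => (Λ.fs c).degree) (fun _ _ => Nat.zero_le _) (Finset.mem_univ c)

theorem MultiPartition.part_le (Λ : MultiPartition r n) (c : Fin r) (i : ℕ) : Λ.part c i ≤ n :=
  (Finsupp.le_degree i (Λ.fs c)).trans (Λ.degree_le c)

theorem MultiPartition.anti (Λ : MultiPartition r n) (c : Fin r) : Antitone (Λ.part c) :=
  antitone_nat_of_succ_le (Λ.antitone c)

instance MultiPartition.finite : Finite (MultiPartition r n) := by
  refine Finite.of_injective
    (fun Λ : MultiPartition r n => fun (c : Fin r) (i : Fin n) =>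
      (⟨Λ.part c i, Nat.lt_succ_of_le (Λ.part_le c i)⟩ : Fin (n + 1))) ?_
  intro Λ Λ' h
  apply MultiPartition.ext'
  intro c a
  rcases Nat.lt_or_ge a n with ha | ha
  · have := congrFun (congrFun h c) ⟨a, ha⟩
    simpa using this
  · rw [Λ.vanish c a ha, Λ'.vanish c a ha]

noncomputable instance MultiPartition.fintype : Fintype (MultiPartition r n) := Fintype.ofFinite _

/-- number of variables of a color -/
def nvar (r k : ℕ) (c : Fin r) : ℕ := if (c : ℕ) = 0 then k + 1 else k

/-- tableaux split into components -/
noncomputable def ssEquiv (Λ : MultiPartition r n) (k : ℕ) :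
    {e : Λ.Box → ℕ //
    (∀ x : Λ.Box, e x < if (x.1.1 : ℕ) = 0 then k + 1 else k) ∧
    (∀ x y : Λ.Box, x.1.1 = y.1.1 → x.1.2.1 = y.1.2.1 → x.1.2.2 < y.1.2.2 →
      e x ≤ e y) ∧
    (∀ x y : Λ.Box, x.1.1 = y.1.1 → x.1.2.2 = y.1.2.2 → x.1.2.1 < y.1.2.1 →
      e x < e y)} ≃ ∀ c, {e // SS (nvar r k c) (Λ.fs c) e} where
  toFun e c := ⟨fun i j => if h : j < Λ.part c i then e.1 ⟨(c, i, j), h⟩ else nvar r k c, by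
    obtain ⟨e, h1, h2, h3⟩ := e
    have h1' : ∀ i j (h : j < Λ.part c i), e ⟨(c, i, j), h⟩ < nvar r k c := fun i j h => h1 _
    refine ⟨fun i j => ?_, fun i j => ?_, fun i j => ?_, fun i i' j hi hj => ?_⟩
    · rw [Λ.fs_apply]
      by_cases h : j < Λ.part c i
      · simp only [h, dite_true]; simpa using h1' i j h
      · simp [h]
    · by_cases h : j < Λ.part c i
      · simp only [h, dite_true]; exact (h1' i j h).le
      · simp [h]
    · by_cases h : j + 1 < Λ.part c i
      · have h' : j < Λ.part c i := by omega
        simp only [h, h', dite_true]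
        exact h2 _ _ rfl rfl (Nat.lt_succ_self j)
      · simp only [h, dite_false]
        by_cases h : j < Λ.part c i
        · simp only [h, dite_true]; exact (h1' i j h).le
        · simp [h]
    · by_cases h : j < Λ.part c i'
      · have h' : j < Λ.part c i := lt_of_lt_of_le h (Λ.anti c hi.le)
        simp only [h, h', dite_true]
        exact h3 _ _ rfl rfl hi
      · simp [h] at hj⟩
  invFun E := ⟨fun x => (E x.1.1).1 x.1.2.1 x.1.2.2, by
    refine ⟨fun x => ((E x.1.1).2.1 _ _).2 x.2, ?_, ?_⟩
    · rintro ⟨⟨c, i, j⟩, h⟩ ⟨⟨c', i', j'⟩, h'⟩ h1 h2 h3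
      dsimp only at h1 h2 h3 ⊢
      subst h1 h2
      exact monotone_nat_of_le_succ ((E c).2.2.2.1 i) h3.le
    · rintro ⟨⟨c, i, j⟩, h⟩ ⟨⟨c', i', j'⟩, h'⟩ h1 h2 h3
      dsimp only at h1 h2 h3 ⊢
      subst h1 h2
      exact (E c).2.2.2.2 i i' j h3 (((E c).2.1 _ _).2 h')⟩
  left_inv e := by
    apply Subtype.ext
    funext x
    have := x.2
    dsimp only
    rw [dif_pos this]; rfl
  right_inv E := by
    funext c
    apply Subtype.ext
    funext i j
    dsimp only
    have h1 := (E c).2.1 i j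
    have h2 := (E c).2.2.1 i j
    rw [Λ.fs_apply] at h1
    split_ifs <;> omega

theorem sCount_eq (Λ : MultiPartition r n) (k : ℕ) :
    sCount Λ k = ∑ α ∈ Fintype.piFinset (fun c : Fin r =>
      Fintype.piFinset (fun _ : Fin (nvar r k c) => Finset.range (n + 1))),
      ∏ c, KC (nvar r k c) (α c) (Λ.fs c) := by
  rw [sCount, Nat.card_congr (ssEquiv Λ k), Nat.card_pi]
  refine Eq.trans ?_ (Finset.prod_univ_sum _ (fun c a => KC (nvar r k c) a (Λ.fs c)))
  exact Finset.prod_congr rfl fun c _ => ss_card _ (Λ.degree_le c)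

end MP

set_option autoImplicit false

section FF

open scoped ENNReal Classical

/-- number of chains with prescribed jumps -/
noncomputable def FF : (n : ℕ) → (Fin n → ℕ) → ℕ → ℕ
  | 0, _, _ => 1
  | n + 1, d, k => ∑ j ∈ Finset.range (k + 1),
      if d (Fin.last n) ≤ j then FF n (Fin.init d) (j - d (Fin.last n)) else 0

/-- chain condition -/
def Chn (n : ℕ) (d : Fin n → ℕ) (k : ℕ) (a : Fin (n + 1) → ℕ) : Prop :=
  a (Fin.last n) = k ∧ ∀ v : Fin n, a v.castSucc + d v ≤ a v.succ

theorem Chn_snoc {n : ℕ} (d : Fin (n + 1) → ℕ) (k x : ℕ) (a : Fin (n + 1) → ℕ) :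
    Chn (n + 1) d k (Fin.snoc a x : Fin (n + 2) → ℕ) ↔
      x = k ∧ a (Fin.last n) + d (Fin.last n) ≤ x ∧
        Chn n (Fin.init d) (a (Fin.last n)) a := by
  unfold Chn
  rw [Fin.forall_fin_succ']
  have e1 : (Fin.snoc a x : Fin (n + 2) → ℕ) (Fin.last (n + 1)) = x := by simp
  have e2 : ∀ v : Fin (n + 1), (Fin.snoc a x : Fin (n + 2) → ℕ) v.castSucc = a v := by simp
  have e3 : ∀ v : Fin n, (Fin.snoc a x : Fin (n + 2) → ℕ) v.castSucc.succ = a v.succ := by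
    intro v; rw [Fin.succ_castSucc, e2]
  rw [e1, e2, Fin.succ_last, e1]
  simp only [e2, e3, Fin.init]
  tauto

theorem FF_count {n : ℕ} : ∀ (d : Fin n → ℕ) (k : ℕ),
    (FF n d k : ℝ≥0∞) = ∑' a, ind (Chn n d k a) := by
  induction n with
  | zero =>
    intro d k
    rw [tsum_eq_single (fun _ => k)]
    · rw [FF, ind, if_pos]; simp
      exact ⟨rfl, fun v => v.elim0⟩
    · intro a ha
      rw [ind, if_neg]
      intro h
      apply ha
      funext i
      rw [← h.1, show i = Fin.last 0 from Fin.ext (by have := i.2; simp)]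
  | succ n ih =>
    intro d k
    rw [← (Fin.snocEquiv (fun _ : Fin (n + 2) => ℕ)).tsum_eq, ENNReal.tsum_prod', tsum_eq_single k]
    · have : ∀ a : Fin (n + 1) → ℕ, ind (Chn (n + 1) d k ((Fin.snocEquiv (fun _ : Fin (n + 2) => ℕ)) (k, a)))
          = ∑' j, ind (j + d (Fin.last n) ≤ k) * ind (Chn n (Fin.init d) j a) := by
        intro a
        have h1 : (Fin.snocEquiv (fun _ : Fin (n + 2) => ℕ)) (k, a) = (Fin.snoc a k : Fin (n + 2) → ℕ) := rfl
        rw [h1, ind_congr (Chn_snoc d k k a), tsum_eq_single (a (Fin.last n))]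
        · rw [← ind_and]; exact ind_congr (by tauto)
        · intro j hj
          have hc : ¬ Chn n (Fin.init d) j a := fun h => hj h.1.symm
          simp [ind, hc]
      simp_rw [this]
      rw [ENNReal.tsum_comm]
      simp_rw [ENNReal.tsum_mul_left, ← ih]
      rw [tsum_eq_sum (s := Finset.range (k + 1 - d (Fin.last n)))]
      · rw [FF]
        push_cast
        rw [← Finset.sum_filter]
        symm
        refine Finset.sum_bij' (fun j _ => j + d (Fin.last n)) (fun j _ => j - d (Fin.last n)) ?_ ?_ ?_ ?_ ?_
        · intro j hj; simp at hj ⊢; omega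
        · intro j hj; simp at hj ⊢; omega
        · intro j hj; simp
        · intro j hj; simp at hj ⊢; omega
        · intro j hj; simp at hj; rw [ind, if_pos (by omega)]; simp
      · intro j hj
        rw [ind, if_neg, zero_mul]
        simp at hj; omega
    · intro x hx
      rw [ENNReal.tsum_eq_zero]
      intro a
      have h1 : (Fin.snocEquiv (fun _ : Fin (n + 2) => ℕ)) (x, a) = (Fin.snoc a x : Fin (n + 2) → ℕ) := rfl
      rw [h1, ind_congr (Chn_snoc d k x a), ind, if_neg]
      tauto

theorem card_of_tsum_ind {α : Type*} {p : α → Prop} {m : ℕ} (h : (m : ℝ≥0∞) = ∑' a, ind (p a)) :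
    Finite {a // p a} ∧ Nat.card {a // p a} = m := by
  rw [tsum_ind, ENNReal.tsum_const, mul_one] at h
  have h2 : ENat.card {e // p e} = (m : ℕ∞) := by
    apply ENat.toENNReal_inj.1
    rw [← h]; rfl
  constructor
  · rw [← ENat.card_lt_top, h2]; exact ENat.natCast_lt_top m
  · change (ENat.card {e // p e}).toNat = _
    rw [h2]; exact ENat.toNat_natCast _

theorem FF_card {n : ℕ} (d : Fin n → ℕ) (k : ℕ) : Finite {a // Chn n d k a} ∧
    Nat.card {a // Chn n d k a} = FF n d k := card_of_tsum_ind (FF_count d k)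

theorem FF_series {n : ℕ} : ∀ (d : Fin n → ℕ),
    (1 - PowerSeries.X : PowerSeries ℂ) ^ (n + 1) * PowerSeries.mk (fun k => (FF n d k : ℂ)) =
      PowerSeries.X ^ (∑ v, d v) := by
  induction n with
  | zero =>
    intro d
    simp only [FF]
    have := PowerSeries.mk_one_mul_one_sub_eq_one ℂ
    simp only [zero_add, pow_one, Nat.cast_one, Finset.univ_eq_empty, Finset.sum_empty, pow_zero]
    rw [mul_comm]; exact this
  | succ n ih =>
    intro d
    have key : (1 - PowerSeries.X : PowerSeries ℂ) * PowerSeries.mk (fun k => (FF (n + 1) d k : ℂ)) =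
      PowerSeries.X ^ (d (Fin.last n)) * PowerSeries.mk (fun k => (FF n (Fin.init d) k : ℂ)) := by
      ext k
      rw [sub_mul, one_mul, map_sub, PowerSeries.coeff_X_pow_mul', PowerSeries.coeff_mk,
        PowerSeries.coeff_mk]
      cases k with
      | zero =>
        rw [PowerSeries.coeff_zero_X_mul, FF]
        simp
      | succ k =>
        rw [PowerSeries.coeff_succ_X_mul, PowerSeries.coeff_mk, FF, FF, Finset.sum_range_succ _ (k + 1)]
        push_cast
        rw [add_sub_cancel_left]
    rw [pow_succ, mul_assoc, key, mul_left_comm, ih, ← pow_add, Fin.sum_univ_castSucc, add_comm]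
    rfl

end FF

section Bij

open scoped Classical

variable {r n : ℕ}

noncomputable instance MultiPartition.boxFintype (Λ : MultiPartition r n) : Fintype Λ.Box :=
  Fintype.ofInjective (fun x : Λ.Box => (x.1.1,
    (⟨x.1.2.1, by by_contra h; have h1 := x.2; rw [Λ.vanish _ _ (not_lt.1 h)] at h1; omega⟩ : Fin n),
    (⟨x.1.2.2, lt_of_lt_of_le x.2 (Λ.part_le _ _)⟩ : Fin n))) (by
      rintro ⟨⟨c, i, j⟩, h⟩ ⟨⟨c', i', j'⟩, h'⟩ hh
      apply Subtype.ext
      simpa using hh)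

theorem MultiPartition.card_box (Λ : MultiPartition r n) : Fintype.card Λ.Box = n := by
  have e : Λ.Box ≃ Σ c : Fin r, Σ a : Fin n, Fin (Λ.part c a) :=
    { toFun := fun x => ⟨x.1.1, ⟨x.1.2.1, by
        by_contra h; have h1 := x.2; rw [Λ.vanish _ _ (not_lt.1 h)] at h1; omega⟩, ⟨x.1.2.2, x.2⟩⟩
      invFun := fun y => ⟨(y.1, y.2.1, y.2.2), y.2.2.2⟩
      left_inv := fun x => rfl
      right_inv := fun y => rfl }
  rw [Fintype.card_congr e, Fintype.card_sigma]
  simp only [Fintype.card_sigma, Fintype.card_fin]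
  conv_rhs => rw [← Λ.size]
  exact Finset.sum_congr rfl fun c _ => (Finset.sum_range _).symm

/-- weak order on boxes -/
def BR {Λ : MultiPartition r n} (x y : Λ.Box) : Prop :=
  x.1.1 < y.1.1 ∨ (x.1.1 = y.1.1 ∧ y.1.2.1 ≤ x.1.2.1)

theorem BR.trans {Λ : MultiPartition r n} {x y z : Λ.Box} (h1 : BR x y) (h2 : BR y z) : BR x z := by
  unfold BR at *; omega

/-- descent indicator -/
noncomputable def StdTableau.dd {Λ : MultiPartition r n} (T : StdTableau Λ) (v : Fin n) : ℕ :=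
  if T.IsDescent v then 1 else 0

theorem StdTableau.sum_dd {Λ : MultiPartition r n} (T : StdTableau Λ) : ∑ v, T.dd v = T.desCount := by
  rw [StdTableau.desCount, Nat.card_eq_fintype_card, Fintype.card_subtype, Finset.card_filter]
  rfl

theorem StdTableau.dd_succ {Λ : MultiPartition r n} (T : StdTableau Λ) {x y : Λ.Box}
    (h : (T.entry x : ℕ) + 1 = T.entry y) : T.dd (T.entry x) = 0 ↔ BR x y := by
  have hlt : (T.entry x : ℕ) + 1 < n := by rw [h]; exact (T.entry y).2
  have hy : T.entry y = ⟨(T.entry x : ℕ) + 1, hlt⟩ := Fin.ext h.symm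
  have : T.IsDescent (T.entry x) ↔ ¬ BR x y := by
    unfold StdTableau.IsDescent BR
    rw [dif_pos hlt]
    constructor
    · rintro ⟨x', y', h1, h2, h3⟩
      have e1 := T.bijective.1 h1
      have e2 := T.bijective.1 (h2.trans hy.symm)
      subst e1 e2
      omega
    · intro h3
      exact ⟨x, y, rfl, hy, by omega⟩
  unfold StdTableau.dd
  rw [this]
  by_cases hb : BR x y <;> simp [hb]

theorem StdTableau.dd_last {Λ : MultiPartition r n} (T : StdTableau Λ) {x : Λ.Box}
    (h : (T.entry x : ℕ) + 1 = n) : T.dd (T.entry x) = 0 ↔ (x.1.1 : ℕ) = 0 := by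
  have hlt : ¬ (T.entry x : ℕ) + 1 < n := by omega
  have : T.IsDescent (T.entry x) ↔ 0 < (x.1.1 : ℕ) := by
    unfold StdTableau.IsDescent
    rw [dif_neg hlt]
    constructor
    · rintro ⟨x', h1, h2⟩
      have e1 := T.bijective.1 h1
      subst e1
      exact h2
    · intro h3
      exact ⟨x, rfl, h3⟩
  unfold StdTableau.dd
  rw [this]
  by_cases hb : (x.1.1 : ℕ) = 0 
  · simp [hb]
  · rw [if_pos (by omega)]; simp [hb]

theorem Chn.mono {d : Fin n → ℕ} {k : ℕ} {a : Fin (n + 1) → ℕ} (h : Chn n d k a) : Monotone a := by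
  rw [Fin.monotone_iff_le_succ]
  intro i
  have := h.2 i
  omega

theorem StdTableau.chain {Λ : MultiPartition r n} (T : StdTableau Λ) {k : ℕ} {a : Fin (n + 1) → ℕ}
    (h : Chn n T.dd k a) (x : Λ.Box) (w : ℕ) (hw : (T.entry x : ℕ) ≤ w) : ∀ (y : Λ.Box),
    (T.entry y : ℕ) = w → a (T.entry x).castSucc = a (T.entry y).castSucc → BR x y := by
  induction w, hw using Nat.le_induction with
  | base =>
    intro y hy _
    have := T.bijective.1 (Fin.ext hy)
    subst this
    right; exact ⟨rfl, le_rfl⟩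
  | succ w hw ih =>
    intro y hy he
    have hn : w < n := by have := (T.entry y).2; omega
    obtain ⟨z, hz⟩ := T.bijective.2 ⟨w, hn⟩
    have hz' : (T.entry z : ℕ) = w := by rw [hz]
    have h1 := h.2 (T.entry z)
    have h2 : (T.entry z).succ = (T.entry y).castSucc := by
      ext; simp [hz', hy]
    rw [h2] at h1
    have h3 : a (T.entry x).castSucc ≤ a (T.entry z).castSucc := h.mono (by
      rw [Fin.castSucc_le_castSucc_iff, Fin.le_def, hz']; exact hw)
    refine (ih z hz' (by omega)).trans ?_
    rw [← T.dd_succ (by omega)]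
    omega

/-- semistandard condition -/
def SSB (Λ : MultiPartition r n) (k : ℕ) (e : Λ.Box → ℕ) : Prop :=
    (∀ x : Λ.Box, e x < if (x.1.1 : ℕ) = 0 then k + 1 else k) ∧
    (∀ x y : Λ.Box, x.1.1 = y.1.1 → x.1.2.1 = y.1.2.1 → x.1.2.2 < y.1.2.2 →
      e x ≤ e y) ∧
    (∀ x y : Λ.Box, x.1.1 = y.1.1 → x.1.2.2 = y.1.2.2 → x.1.2.1 < y.1.2.1 →
      e x < e y)

theorem StdTableau.ssb {Λ : MultiPartition r n} (T : StdTableau Λ) {k : ℕ} {a : Fin (n + 1) → ℕ}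
    (h : Chn n T.dd k a) : SSB Λ k (fun x => a (T.entry x).castSucc) := by
  refine ⟨fun x => ?_, fun x y h1 h2 h3 => ?_, fun x y h1 h2 h3 => ?_⟩
  · have hn : n - 1 < n := by have := (T.entry x).2; omega
    obtain ⟨z, hz⟩ := T.bijective.2 ⟨n - 1, hn⟩
    have hz' : (T.entry z : ℕ) = n - 1 := by rw [hz]
    have h1 := h.2 (T.entry z)
    have h2 : (T.entry z).succ = Fin.last n := by
      ext; simp [hz']; omega
    rw [h2, h.1] at h1
    have hxz : T.entry x ≤ T.entry z := by
      rw [Fin.le_def, hz']; have := (T.entry x).2; omega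
    have h3 : a (T.entry x).castSucc ≤ a (T.entry z).castSucc := h.mono (by
      rw [Fin.castSucc_le_castSucc_iff]; exact hxz)
    dsimp only
    split_ifs with hx
    · omega
    · by_contra hc
      have h4 := T.chain h x _ hxz z rfl (by omega)
      have h5 := (T.dd_last (x := z) (by omega)).1 (by omega)
      unfold BR at h4
      omega
  · exact h.mono (by rw [Fin.castSucc_le_castSucc_iff]; exact (T.row_lt x y h1 h2 h3).le)
  · have hlt := T.col_lt x y h1 h2 h3
    have hle : a (T.entry x).castSucc ≤ a (T.entry y).castSucc := h.mono (by
      rw [Fin.castSucc_le_castSucc_iff]; exact hlt.le)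
    rcases hle.lt_or_eq with h4 | h4
    · exact h4
    · have := T.chain h x _ hlt.le y rfl h4
      unfold BR at this
      omega

/-- sort key -/
def bkey {Λ : MultiPartition r n} (e : Λ.Box → ℕ) (x : Λ.Box) : ℕ ×ₗ (Fin r ×ₗ (ℕᵒᵈ ×ₗ ℕ)) :=
  toLex (e x, toLex (x.1.1, toLex (OrderDual.toDual x.1.2.1, x.1.2.2)))

theorem bkey_inj {Λ : MultiPartition r n} (e : Λ.Box → ℕ) : Function.Injective (bkey e) := by
  rintro ⟨⟨c, i, j⟩, h⟩ ⟨⟨c', i', j'⟩, h'⟩ hh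
  apply Subtype.ext
  simp [bkey] at hh
  simp [hh]

theorem bkey_lt {Λ : MultiPartition r n} (e : Λ.Box → ℕ) (x y : Λ.Box) : bkey e x < bkey e y ↔
    e x < e y ∨ (e x = e y ∧ (x.1.1 < y.1.1 ∨ (x.1.1 = y.1.1 ∧ (y.1.2.1 < x.1.2.1 ∨
      (x.1.2.1 = y.1.2.1 ∧ x.1.2.2 < y.1.2.2))))) := by
  simp [bkey, Prod.Lex.toLex_lt_toLex]

theorem StdTableau.key_mono {Λ : MultiPartition r n} (T : StdTableau Λ) {k : ℕ} {a : Fin (n + 1) → ℕ}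
    (h : Chn n T.dd k a) {x y : Λ.Box} (hxy : T.entry x < T.entry y) :
    bkey (fun x => a (T.entry x).castSucc) x < bkey (fun x => a (T.entry x).castSucc) y := by
  rw [bkey_lt]
  have hle : a (T.entry x).castSucc ≤ a (T.entry y).castSucc := h.mono (by
      rw [Fin.castSucc_le_castSucc_iff]; exact hxy.le)
  rcases hle.lt_or_eq with h4 | h4
  · exact Or.inl h4
  · right
    refine ⟨h4, ?_⟩
    have h5 := T.chain h x _ hxy.le y rfl h4
    unfold BR at h5
    rcases h5 with h5 | ⟨h5, h6⟩
    · exact Or.inl h5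
    · right
      refine ⟨h5, ?_⟩
      rcases h6.lt_or_eq with h7 | h7
      · exact Or.inl h7
      · right
        refine ⟨h7.symm, ?_⟩
        by_contra hc
        rcases (not_lt.1 hc).lt_or_eq with h8 | h8
        · exact absurd (T.row_lt y x h5.symm h7 h8) (not_lt.2 hxy.le)
        · have : x = y := by
            apply Subtype.ext
            exact Prod.ext h5 (Prod.ext h7.symm h8.symm)
          subst this
          exact lt_irrefl _ hxy

theorem StdTableau.ext' {Λ : MultiPartition r n} {T T' : StdTableau Λ} (h : T.entry = T'.entry) : T = T' := by
  cases T; cases T'; congr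

theorem tab_surj {Λ : MultiPartition r n} {k : ℕ} {e : Λ.Box → ℕ} (he : SSB Λ k e) :
    ∃ (T : StdTableau Λ) (a : Fin (n + 1) → ℕ), Chn n T.dd k a ∧ (fun x => a (T.entry x).castSucc) = e := by
  let _ : LinearOrder Λ.Box := LinearOrder.lift' (bkey e) (bkey_inj e)
  have hlt : ∀ x y : Λ.Box, x < y ↔ bkey e x < bkey e y := fun x y => Iff.rfl
  let s : Fin n ≃o Λ.Box := Fintype.orderIsoFinOfCardEq Λ.Box Λ.card_box
  obtain ⟨h1, h2, h3⟩ := he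
  let T : StdTableau Λ :=
    { entry := s.symm
      bijective := s.symm.bijective
      row_lt := fun x y a1 a2 a3 => by
        rw [OrderIso.lt_iff_lt, hlt, bkey_lt]
        have := h2 x y a1 a2 a3
        omega
      col_lt := fun x y a1 a2 a3 => by
        rw [OrderIso.lt_iff_lt, hlt, bkey_lt]
        exact Or.inl (h3 x y a1 a2 a3) }
  have hT : ∀ x, T.entry x = s.symm x := fun _ => rfl
  have hc : ∀ x, (Fin.snoc (fun v => e (s v)) k : Fin (n + 1) → ℕ) (T.entry x).castSucc = e x := by
    intro x; rw [Fin.snoc_castSucc, hT, s.apply_symm_apply]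
  refine ⟨T, (Fin.snoc (fun v => e (s v)) k : Fin (n + 1) → ℕ), ⟨Fin.snoc_last _ _, ?_⟩, funext hc⟩
  intro v
  obtain ⟨x, rfl⟩ := T.bijective.2 v
  rw [hc]
  by_cases hv : (T.entry x : ℕ) + 1 < n
  · obtain ⟨y, hy⟩ := T.bijective.2 ⟨_, hv⟩
    have h4 : (T.entry x).succ = (T.entry y).castSucc := by
      ext; simp [hy]
    rw [h4, hc]
    have hxy : x < y := by
      rw [← s.symm.lt_iff_lt]
      change T.entry x < T.entry y
      rw [Fin.lt_def, hy]; simp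
    rw [hlt, bkey_lt] at hxy
    have h5 := T.dd_succ (x := x) (y := y) (by rw [hy])
    unfold BR at h5
    have h6 : T.dd (T.entry x) ≤ 1 := by unfold StdTableau.dd; split_ifs <;> simp
    omega
  · have hx := (T.entry x).2
    have h4 : (T.entry x).succ = Fin.last n := by
      ext; simp; omega
    rw [h4, Fin.snoc_last]
    have h5 := T.dd_last (x := x) (by omega)
    have h6 : T.dd (T.entry x) ≤ 1 := by unfold StdTableau.dd; split_ifs <;> simp
    have h7 := h1 x
    split_ifs at h7 <;> omega

instance StdTableau.finite (Λ : MultiPartition r n) : Finite (StdTableau Λ) :=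
  Finite.of_injective (fun T : StdTableau Λ => T.entry) (fun _ _ h => StdTableau.ext' h)

noncomputable instance StdTableau.fintype (Λ : MultiPartition r n) : Fintype (StdTableau Λ) :=
  Fintype.ofFinite _

theorem sCount_eq_FF (Λ : MultiPartition r n) (k : ℕ) :
    sCount Λ k = ∑ T : StdTableau Λ, FF n T.dd k := by
  have : ∀ T : StdTableau Λ, Finite {a // Chn n T.dd k a} := fun T => (FF_card T.dd k).1
  simp_rw [← fun T : StdTableau Λ => (FF_card T.dd k).2]
  rw [← Nat.card_sigma]
  symm
  refine Nat.card_congr (Equiv.ofBijective (fun p : (Σ T : StdTableau Λ, {a // Chn n T.dd k a}) =>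
    (⟨fun x => p.2.1 (p.1.entry x).castSucc, p.1.ssb p.2.2⟩ : {e // SSB Λ k e})) ⟨?_, ?_⟩)
  · rintro ⟨T, a, ha⟩ ⟨T', a', ha'⟩ h
    have h := congrArg Subtype.val h
    dsimp only at h
    have hm := fun x y => T.key_mono ha (x := x) (y := y)
    have hm' := fun x y => T'.key_mono ha' (x := x) (y := y)
    rw [← h] at hm'
    have hT : T = T' := by
      apply StdTableau.ext'
      have hs : StrictMono (T'.entry ∘ (Equiv.ofBijective _ T.bijective).symm) := by
        intro u v huv
        obtain ⟨x, rfl⟩ := T.bijective.2 u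
        obtain ⟨y, rfl⟩ := T.bijective.2 v
        simp only [Function.comp, Equiv.ofBijective_symm_apply_apply]
        by_contra hc
        rcases (not_lt.1 hc).lt_or_eq with h8 | h8
        · exact absurd (hm' _ _ h8) (not_lt.2 (hm _ _ huv).le)
        · rw [T'.bijective.1 h8] at huv
          exact lt_irrefl _ huv
      have h2 := (StrictMono.range_inj hs strictMono_id).1 (by
        rw [Set.range_id, Set.range_eq_univ]
        exact T'.bijective.2.comp (Equiv.surjective _))
      funext x
      have := congrFun h2 (T.entry x)
      simp only [Function.comp, Equiv.ofBijective_symm_apply_apply] at this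
      exact this.symm
    subst hT
    have : a = a' := by
      funext i
      refine Fin.lastCases ?_ (fun v => ?_) i
      · rw [ha.1, ha'.1]
      · obtain ⟨x, rfl⟩ := T.bijective.2 v
        exact congrFun h x
    subst this
    rfl
  · rintro ⟨e, he⟩
    obtain ⟨T, a, h1, h2⟩ := tab_surj he
    exact ⟨⟨T, a, h1⟩, Subtype.ext h2⟩

theorem mCount_eq (Λ : MultiPartition r n) (k : ℕ) :
    (mCount Λ k : ℂ) = ∑ j ∈ Finset.range (k + 1),
      (-1 : ℂ) ^ j * ((n + 1).choose j : ℂ) * (sCount Λ (k - j) : ℂ) := by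
  have h1 : (mCount Λ k : ℂ) = PowerSeries.coeff k (∑ T : StdTableau Λ,
      (PowerSeries.X : PowerSeries ℂ) ^ (T.desCount)) := by
    rw [map_sum, mCount, Nat.card_eq_fintype_card, Fintype.card_subtype, Finset.card_filter]
    push_cast
    refine Finset.sum_congr rfl fun T _ => ?_
    rw [PowerSeries.coeff_X_pow]
    simp [eq_comm]
  rw [h1]
  simp_rw [← StdTableau.sum_dd, ← FF_series]
  rw [← Finset.mul_sum, PowerSeries.coeff_mul, Finset.Nat.sum_antidiagonal_eq_sum_range_succ_mk]
  refine Finset.sum_congr rfl fun j _ => ?_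
  dsimp only
  congr 1
  · have : (1 - PowerSeries.X : PowerSeries ℂ) ^ (n + 1) =
      (((1 - Polynomial.X : Polynomial ℂ) ^ (n + 1) : Polynomial ℂ) : PowerSeries ℂ) := by simp
    have h3 : (1 - Polynomial.X : Polynomial ℂ) ^ (n + 1) =
        ((1 + Polynomial.X : Polynomial ℂ) ^ (n + 1)).comp (Polynomial.C (-1) * Polynomial.X) := by
      simp [sub_eq_add_neg]
    rw [this, Polynomial.coeff_coe, h3, Polynomial.comp_C_mul_X_coeff, Polynomial.coeff_one_add_X_pow, mul_comm]
  · rw [map_sum, sCount_eq_FF]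
    push_cast
    simp

end Bij

set_option autoImplicit false
set_option linter.unusedSectionVars false

section Mono

open scoped Classical

variable {r n : ℕ} [NeZero r]

noncomputable instance wreathFintype : Fintype (WreathProduct r n) :=
  haveI : Fintype (Fin n → Multiplicative (ZMod r)) := inferInstance
  Fintype.ofEquiv _ (SemidirectProduct.equivProd (φ :=
    (mulAutArrow : Equiv.Perm (Fin n) →* MulAut (Fin n → Multiplicative (ZMod r))))).symm

/-- underlying vector -/
def WreathProduct.vec (g : WreathProduct r n) (i : Fin n) : ZMod r := Multiplicative.toAdd (g.left i)

theorem vec_mul (g h : WreathProduct r n) (i : Fin n) :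
    (g * h).vec i = g.vec i + h.vec (g.right⁻¹ i) := by
  simp only [WreathProduct.vec, SemidirectProduct.mul_left, Pi.mul_apply, toAdd_mul]
  rfl

theorem vec_inv (g : WreathProduct r n) (i : Fin n) :
    (g⁻¹).vec i = - g.vec (g.right i) := by
  simp only [WreathProduct.vec, SemidirectProduct.inv_left]
  change Multiplicative.toAdd ((g.left⁻¹) ((g.right⁻¹)⁻¹ i)) = _
  simp

variable {A : Type} [Fintype A] (col : A → ZMod r)

/-- phase -/
noncomputable def phase (f : Fin n → ZMod r) (w : Fin n → A) : ℂ :=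
  ZMod.stdAddChar (∑ i, col (w i) * f i)

/-- content -/
noncomputable def cnt {A : Type} (w : Fin n → A) (a : A) : ℕ := (Finset.univ.filter (fun i => w i = a)).card

theorem cnt_comp {A : Type} (w : Fin n → A) (σ : Equiv.Perm (Fin n)) : cnt (w ∘ σ) = cnt w := by
  funext a
  unfold cnt
  refine Finset.card_bij (fun i _ => σ i) (by simp) (by simp) ?_
  intro b hb
  exact ⟨σ.symm b, by simpa using hb, by simp⟩

/-- monomial representation -/
noncomputable def monRep (α : A → ℕ) :
    Representation ℂ (WreathProduct r n) ({w : Fin n → A // cnt w = α} → ℂ) where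
  toFun g :=
    { toFun := fun v w => phase col g.vec w.1 * v ⟨w.1 ∘ g.right, by rw [cnt_comp]; exact w.2⟩
      map_add' := fun v v' => by funext w; simp [mul_add]
      map_smul' := fun c v => by funext w; simp; ring }
  map_one' := by
    ext v w
    simp [phase, WreathProduct.vec]
  map_mul' g h := by
    refine LinearMap.ext fun v => funext fun w => ?_
    change phase col (g * h).vec w.1 * v _ = phase col g.vec w.1 * (phase col h.vec (w.1 ∘ g.right) * v _)
    rw [← mul_assoc]
    congr 1
    unfold phase
    rw [← AddChar.map_add_eq_mul]
    congr 1
    simp_rw [vec_mul, mul_add]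
    rw [Finset.sum_add_distrib]
    congr 1
    rw [← Equiv.sum_comp g.right]
    simp

/-- monomial character -/
noncomputable def Mch (α : A → ℕ) (g : WreathProduct r n) : ℂ :=
  ∑ w : Fin n → A, if cnt w = α ∧ w ∘ g.right = w then phase col g.vec w else 0

theorem monRep_char (α : A → ℕ) : (monRep (n := n) col α).character = Mch col α := by
  funext g
  unfold Representation.character
  rw [LinearMap.trace_eq_matrix_trace ℂ (Pi.basisFun ℂ _), Matrix.trace]
  simp only [Matrix.diag, LinearMap.toMatrix_apply, Pi.basisFun_apply, Pi.basisFun_repr]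
  unfold Mch
  simp_rw [ite_and]
  rw [← Finset.sum_filter, ← Finset.sum_subtype_eq_sum_filter]
  rw [Finset.subtype_univ]
  refine Finset.sum_congr rfl fun w _ => ?_
  change phase col g.vec w.1 * (Pi.single w (1 : ℂ) : _ → ℂ) ⟨w.1 ∘ g.right, _⟩ = _
  rw [Pi.single_apply]
  simp only [Subtype.ext_iff, mul_ite, mul_one, mul_zero]

end Mono

set_option autoImplicit false

set_option linter.unusedSectionVars false
section CharTheory
variable {G : Type} [Group G] [Fintype G]

/-- irreducible characters -/
def FIrr (G : Type) [Group G] (χ : G → ℂ) : Prop :=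
  ∃ V : FDRep ℂ G, CategoryTheory.Simple V ∧ χ = V.character

/-- scalar product of class functions -/
noncomputable def fform (f h : G → ℂ) : ℂ :=
  (Nat.card G : ℂ)⁻¹ * ∑ g : G, f g * h g⁻¹

theorem fform_comm (f h : G → ℂ) : fform f h = fform h f := by
  unfold fform
  congr 1
  rw [← Equiv.sum_comp (Equiv.inv G)]
  simp [mul_comm]

theorem fform_add_left (f f' h : G → ℂ) : fform (f + f') h = fform f h + fform f' h := by
  simp [fform, add_mul, Finset.sum_add_distrib, mul_add]

theorem fform_smul_left (a : ℂ) (f h : G → ℂ) : fform (a • f) h = a * fform f h := by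
  simp only [fform, Pi.smul_apply, smul_eq_mul, mul_assoc, ← Finset.mul_sum]
  ring

theorem fform_sum_left {ι : Type*} (s : Finset ι) (F : ι → G → ℂ) (h : G → ℂ) :
    fform (∑ i ∈ s, F i) h = ∑ i ∈ s, fform (F i) h := by
  classical
  induction s using Finset.induction_on with
  | empty => simp [fform]
  | insert a s ha ih => rw [Finset.sum_insert ha, Finset.sum_insert ha, fform_add_left, ih]

theorem fform_add_right (h f f' : G → ℂ) : fform h (f + f') = fform h f + fform h f' := by
  rw [fform_comm, fform_add_left, fform_comm f, fform_comm f']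

theorem fform_smul_right (a : ℂ) (h f : G → ℂ) : fform h (a • f) = a * fform h f := by
  rw [fform_comm, fform_smul_left, fform_comm f]

theorem fform_sub_right (h f f' : G → ℂ) : fform h (f - f') = fform h f - fform h f' := by
  have : f - f' = f + (-1 : ℂ) • f' := by simp [sub_eq_add_neg]
  rw [this, fform_add_right, fform_smul_right]; ring

theorem fform_sub_left (h f f' : G → ℂ) : fform (f - f') h = fform f h - fform f' h := by
  rw [fform_comm, fform_sub_right, fform_comm h, fform_comm h]

theorem fform_sum_right {ι : Type*} (s : Finset ι) (F : ι → G → ℂ) (h : G → ℂ) :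
    fform h (∑ i ∈ s, F i) = ∑ i ∈ s, fform h (F i) := by
  rw [fform_comm, fform_sum_left]
  exact Finset.sum_congr rfl fun i _ => fform_comm _ _

theorem fform_irr {χ ψ : G → ℂ} (hχ : FIrr G χ) (hψ : FIrr G ψ) [Decidable (χ = ψ)] :
    fform χ ψ = if χ = ψ then 1 else 0 := by
  classical
  obtain ⟨V, hV, rfl⟩ := hχ
  obtain ⟨W, hW, rfl⟩ := hψ
  have := invertibleOfNonzero (NeZero.ne (Nat.card G : ℂ))
  have h := FDRep.char_orthonormal V W
  have h2 := FDRep.char_orthonormal W W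
  by_cases hi : Nonempty (V ≅ W)
  · have : V.character = W.character := FDRep.char_iso hi.some
    rw [if_pos this, fform, h, if_pos hi]
  · rw [if_neg hi] at h
    have : V.character ≠ W.character := by
      intro e
      rw [e, h2, if_pos ⟨CategoryTheory.Iso.refl W⟩] at h
      exact one_ne_zero h
    rw [if_neg this, fform, h]

theorem firr_of_irreducible {V : Type} [AddCommGroup V] [Module ℂ V] [FiniteDimensional ℂ V]
    (ρ : Representation ℂ G V) [ρ.IsIrreducible] : FIrr G ρ.character := by
  refine ⟨FDRep.of ρ, ?_, rfl⟩
  have := invertibleOfNonzero (NeZero.ne (Nat.card G : ℂ))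
  rw [FDRep.simple_iff_char_is_norm_one]
  have h := Representation.char_orthonormal ρ ρ
  rw [if_pos ⟨Representation.Equiv.refl ρ⟩, inv_mul_eq_one₀ (NeZero.ne _)] at h
  exact h.symm

theorem char_mem_closure_aux (m : ℕ) : ∀ {V : Type} [AddCommGroup V] [Module ℂ V]
    [FiniteDimensional ℂ V] (ρ : Representation ℂ G V), Module.finrank ℂ V = m →
    ρ.character ∈ AddSubmonoid.closure {χ | FIrr G χ} := by
  induction m using Nat.strong_induction_on with
  | _ m ih =>
  intro V _ _ _ ρ hm
  by_cases hn : Nontrivial (Subrepresentation ρ)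
  · by_cases hi : ρ.IsIrreducible
    · exact AddSubmonoid.subset_closure (firr_of_irreducible ρ)
    · obtain ⟨σ, h0, h1⟩ : ∃ σ : Subrepresentation ρ, σ ≠ ⊥ ∧ σ ≠ ⊤ := by
        by_contra hc
        push Not at hc
        exact hi ⟨fun a => or_iff_not_imp_left.2 (hc a)⟩
      obtain ⟨τ, hτ⟩ := exists_isCompl σ
      have hc : IsCompl σ.toSubmodule τ.toSubmodule := by
        constructor
        · rw [disjoint_iff, ← Subrepresentation.toSubmodule_inf, hτ.inf_eq_bot]; rfl
        · rw [codisjoint_iff, ← Subrepresentation.toSubmodule_sup, hτ.sup_eq_top]; rfl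
      have hσ0 : σ.toSubmodule ≠ ⊥ := fun h => h0 (Subrepresentation.toSubmodule_injective h)
      have hσ1 : σ.toSubmodule ≠ ⊤ := fun h => h1 (Subrepresentation.toSubmodule_injective h)
      have hdim := Submodule.finrank_add_eq_of_isCompl hc
      have hl := Submodule.finrank_lt hσ1
      have hp : 0 < Module.finrank ℂ σ.toSubmodule := by
        rw [Module.finrank_pos_iff]
        exact Submodule.nontrivial_iff_ne_bot.2 hσ0
      have e : ρ.character = σ.toRepresentation.character + τ.toRepresentation.character := by
        ext g
        have hinternal := (DirectSum.isInternal_submodule_iff_isCompl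
          (fun b : Bool => if b then σ.toSubmodule else τ.toSubmodule) (i := true) (j := false)
          (by simp) (by ext b; cases b <;> simp)).2 (by simpa using hc)
        have := LinearMap.trace_eq_sum_trace_restrict hinternal (f := ρ g) (by
          intro b; cases b
          · exact fun v hv => τ.apply_mem_toSubmodule g hv
          · exact fun v hv => σ.apply_mem_toSubmodule g hv)
        rw [Fintype.sum_bool] at this
        exact this
      rw [e]
      exact add_mem (ih _ (by omega) _ rfl) (ih _ (by omega) _ rfl)
  · have : ρ.character = 0 := by
      have hs : Subsingleton V := by
        by_contra hV
        rw [not_subsingleton_iff_nontrivial] at hV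
        apply hn
        refine ⟨⊥, ⊤, fun h => ?_⟩
        have := congrArg Subrepresentation.toSubmodule h
        exact bot_ne_top (α := Submodule ℂ V) this
      ext g
      have : ρ g = 0 := by ext v; exact Subsingleton.elim _ _
      simp [Representation.character, this]
    rw [this]; exact zero_mem _

theorem char_mem_closure {V : Type} [AddCommGroup V] [Module ℂ V]
    [FiniteDimensional ℂ V] (ρ : Representation ℂ G V) :
    ρ.character ∈ AddSubmonoid.closure {χ | FIrr G χ} := char_mem_closure_aux _ ρ rfl

/-- integral combination of irreducibles -/
theorem exists_finsupp {v : G → ℂ} (hv : v ∈ AddSubgroup.closure {χ | FIrr G χ}) :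
    ∃ c : {χ // FIrr G χ} →₀ ℤ, v = ∑ χ ∈ c.support, (c χ : ℂ) • χ.1 := by
  have key : ∃ c : {χ // FIrr G χ} →₀ ℤ, v = c.sum fun χ z => (z : ℂ) • χ.1 := by
    induction hv using AddSubgroup.closure_induction with
    | mem x hx => exact ⟨Finsupp.single ⟨x, hx⟩ 1, by simp⟩
    | zero => exact ⟨0, by simp⟩
    | add x y _ _ hx hy =>
      obtain ⟨c, rfl⟩ := hx
      obtain ⟨d, rfl⟩ := hy
      refine ⟨c + d, ?_⟩
      rw [Finsupp.sum_add_index' (by simp) (by intros; simp [add_smul])]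
    | neg x _ hx =>
      obtain ⟨c, rfl⟩ := hx
      refine ⟨-c, ?_⟩
      rw [Finsupp.sum_neg_index (by simp)]
      simp [Finsupp.sum]
  exact key

theorem fform_finsupp (c : {χ // FIrr G χ} →₀ ℤ) :
    fform (∑ χ ∈ c.support, (c χ : ℂ) • χ.1) (∑ χ ∈ c.support, (c χ : ℂ) • χ.1)
      = ((∑ χ ∈ c.support, c χ ^ 2 : ℤ) : ℂ) := by
  classical
  rw [fform_sum_left, Int.cast_sum]
  refine Finset.sum_congr rfl fun χ hχ => ?_
  rw [fform_smul_left, fform_sum_right]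
  simp_rw [fform_smul_right, fform_irr χ.2 (Subtype.property _), ← Subtype.ext_iff]
  rw [Finset.sum_eq_single χ]
  · simp [sq]
  · intro b _ hb; simp [hb.symm]
  · intro h; exact absurd hχ h

theorem eq_zero_of_fform {v : G → ℂ} (hv : v ∈ AddSubgroup.closure {χ | FIrr G χ})
    (h : fform v v = 0) : v = 0 := by
  obtain ⟨c, rfl⟩ := exists_finsupp hv
  rw [fform_finsupp] at h
  have h' : (∑ χ ∈ c.support, c χ ^ 2 : ℤ) = 0 := by exact_mod_cast h
  rw [Finset.sum_eq_zero_iff_of_nonneg (fun _ _ => sq_nonneg _)] at h'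
  refine Finset.sum_eq_zero fun χ hχ => ?_
  have := h' χ hχ
  simp at this
  simp [this]

theorem irr_of_fform {v : G → ℂ} (hv : v ∈ AddSubgroup.closure {χ | FIrr G χ})
    (h : fform v v = 1) : FIrr G v ∨ FIrr G (-v) := by
  obtain ⟨c, rfl⟩ := exists_finsupp hv
  rw [fform_finsupp] at h
  have h' : (∑ χ ∈ c.support, c χ ^ 2 : ℤ) = 1 := by exact_mod_cast h
  have h1 : ∀ χ ∈ c.support, 1 ≤ c χ ^ 2 := fun χ hχ =>
    Order.one_le_iff_pos.2 (sq_pos_iff.2 (Finsupp.mem_support_iff.1 hχ))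
  have hcard : c.support.card = 1 := by
    have hle : (c.support.card : ℤ) ≤ 1 := by
      rw [← h']; simpa using Finset.sum_le_sum h1
    have : c.support.card ≠ 0 := by
      intro h0
      rw [Finset.card_eq_zero] at h0
      rw [h0] at h'; simp at h'
    omega
  obtain ⟨χ, hχ⟩ := Finset.card_eq_one.1 hcard
  rw [hχ] at h' ⊢
  simp only [Finset.sum_singleton, sq_eq_one_iff] at h' ⊢
  rcases h' with h' | h'
  · left; rw [h']; simpa using χ.2
  · right; rw [h']; simpa using χ.2

/-- pairing of a genuine character and an irreducible one is a natural number -/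
theorem fform_char_irr {f χ : G → ℂ} (hf : f ∈ AddSubmonoid.closure {χ | FIrr G χ})
    (hχ : FIrr G χ) : ∃ m : ℕ, fform f χ = m := by
  classical
  induction hf using AddSubmonoid.closure_induction with
  | mem x hx => 
    rw [fform_irr hx hχ]
    by_cases h : x = χ
    · exact ⟨1, by simp [h]⟩
    · exact ⟨0, by simp [h]⟩
  | zero => exact ⟨0, by simp [fform]⟩
  | add x y _ _ hx hy =>
    obtain ⟨a, ha⟩ := hx
    obtain ⟨b, hb⟩ := hy
    exact ⟨a + b, by rw [fform_add_left, ha, hb]; simp⟩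

/-- Gram lemma -/
theorem gram_lemma {I B : Type*} [Fintype I] (M : B → G → ℂ)
    (hM : ∀ b, M b ∈ AddSubmonoid.closure {χ | FIrr G χ})
    (K : I → B → ℕ) (wt : I → B) (rank : I → ℕ)
    (hdiag : ∀ i, K i (wt i) = 1)
    (htri : ∀ i j, j ≠ i → K j (wt i) ≠ 0 → rank j < rank i)
    (hgram : ∀ a b, fform (M a) (M b) = ((∑ i, K i a * K i b : ℕ) : ℂ)) :
    ∃ X : I → G → ℂ, (∀ i, FIrr G (X i)) ∧ Function.Injective X ∧
      ∀ b, M b = ∑ i, (K i b : ℂ) • X i := by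
  classical
  have hM' : ∀ b, M b ∈ AddSubgroup.closure {χ | FIrr G χ} := fun b =>
    (AddSubmonoid.closure_le (S := (AddSubgroup.closure {χ | FIrr G χ}).toAddSubmonoid)).2
      AddSubgroup.subset_closure (hM b)
  -- construct X
  obtain ⟨X, hX⟩ : ∃ X : I → G → ℂ, ∀ i, X i =
      M (wt i) - ∑ j ∈ Finset.univ.filter (fun j => rank j < rank i), (K j (wt i) : ℂ) • X j := by
    let X : I → G → ℂ := (measure rank).wf.fix (fun i X => M (wt i) -
      ∑ j : {j // rank j < rank i}, (K j (wt i) : ℂ) • X j.1 j.2)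
    refine ⟨X, fun i => ?_⟩
    show (measure rank).wf.fix _ i = _
    rw [WellFounded.fix_eq]
    congr 1
    rw [Finset.sum_subtype (p := fun j => rank j < rank i) _ (by simp)]
  have hXmem : ∀ i, X i ∈ AddSubgroup.closure {χ | FIrr G χ} := by
    intro i
    induction hi : rank i using Nat.strong_induction_on generalizing i with
    | _ m ih =>
    rw [hX]
    refine sub_mem (hM' _) (sum_mem fun j hj => ?_)
    rw [Nat.cast_smul_eq_nsmul]
    exact nsmul_mem (ih _ (by simpa [← hi] using hj) j rfl) _
  have hsum : ∀ i (f : I → ℂ), ∑ j, (K j (wt i) : ℂ) * f j = f i +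
      ∑ j ∈ Finset.univ.filter (fun j => rank j < rank i), (K j (wt i) : ℂ) * f j := by
    intro i f
    rw [← Finset.add_sum_erase _ _ (Finset.mem_univ i), hdiag, Nat.cast_one, one_mul]
    congr 1
    symm
    refine Finset.sum_subset ?_ ?_
    · intro j hj; simp at hj ⊢; rintro rfl; omega
    · intro j hj hj'
      simp at hj hj'
      have : K j (wt i) = 0 := by
        by_contra h
        have := htri i j hj h
        omega
      simp [this]
  have hMX : ∀ a i, fform (M a) (X i) = K i a := by
    intro a i
    induction hi : rank i using Nat.strong_induction_on generalizing i with
    | _ m ih =>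
    rw [hX, fform_sub_right, hgram, fform_sum_right]
    have h1 : ∀ j ∈ Finset.univ.filter (fun j => rank j < rank i),
        fform (M a) ((K j (wt i) : ℂ) • X j) = (K j (wt i) : ℂ) * K j a := by
      intro j hj
      rw [fform_smul_right, ih _ (by simpa [← hi] using hj) j rfl]
    rw [Finset.sum_congr rfl h1]
    have := hsum i (fun j => (K j a : ℂ))
    push_cast
    simp_rw [mul_comm (K _ a : ℂ)]
    rw [this]; ring
  have hXX : ∀ j i, fform (X j) (X i) = if j = i then 1 else 0 := by
    intro j i
    induction hi : rank i using Nat.strong_induction_on generalizing i with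
    | _ m ih =>
    rw [hX i, fform_sub_right, fform_comm (X j), hMX, fform_sum_right]
    have h1 : ∀ l ∈ Finset.univ.filter (fun j => rank j < rank i),
        fform (X j) ((K l (wt i) : ℂ) • X l) = (K l (wt i) : ℂ) * if j = l then 1 else 0 := by
      intro l hl
      rw [fform_smul_right, ih _ (by simpa [← hi] using hl) l rfl]
    rw [Finset.sum_congr rfl h1]
    have := hsum i (fun l => if j = l then 1 else 0)
    simp only [mul_ite, mul_one, mul_zero, Finset.sum_ite_eq, Finset.mem_univ, if_true] at this ⊢
    linear_combination this
  refine ⟨X, ?_, ?_, ?_⟩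
  · intro i
    rcases irr_of_fform (hXmem i) (by rw [hXX]; simp) with h | h
    · exact h
    · exfalso
      obtain ⟨m, hm⟩ := fform_char_irr (hM (wt i)) h
      have h2 : -X i = (-1 : ℂ) • X i := by simp
      rw [h2, fform_smul_right, hMX, hdiag] at hm
      have : ((m + 1 : ℕ) : ℂ) = 0 := by push_cast; rw [← hm]; norm_num
      exact absurd this (by exact_mod_cast Nat.succ_ne_zero m)
  · intro i j hij
    have h1 := hXX i i
    have h2 := hXX i j
    rw [← hij, h1] at h2
    by_contra hne
    simp [hne] at h2
  · intro b
    rw [← sub_eq_zero]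
    apply eq_zero_of_fform
    · refine sub_mem (hM' b) (sum_mem fun i _ => ?_)
      rw [Nat.cast_smul_eq_nsmul]
      exact nsmul_mem (hXmem i) _
    · have hb : fform (M b) (∑ i, (K i b : ℂ) • X i) = ∑ i, (K i b : ℂ) * K i b := by
        rw [fform_sum_right]
        simp_rw [fform_smul_right, hMX]
      have hc : fform (∑ i, (K i b : ℂ) • X i) (∑ i, (K i b : ℂ) • X i)
          = ∑ i, (K i b : ℂ) * K i b := by
        rw [fform_sum_left]
        simp_rw [fform_sum_right, fform_smul_left, fform_smul_right, hXX]
        simp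
      rw [fform_sub_left, fform_sub_right, fform_sub_right, hc, hb, hgram,
        fform_comm _ (M b), hb]
      push_cast; ring

end CharTheory

set_option autoImplicit false
set_option linter.unusedSectionVars false

section Burn

open scoped Classical

variable {n : ℕ}

theorem cnt_sum {C : Type} [Fintype C] (p : Fin n → C) : ∑ c, cnt p c = n := by
  unfold cnt
  rw [← Finset.card_eq_sum_card_fiberwise (s := Finset.univ) (t := Finset.univ) (f := p) (by simp)]
  simp

theorem cnt_surj {C : Type} [Fintype C] (γ : C → ℕ) (h : ∑ c, γ c = n) : ∃ p : Fin n → C, cnt p = γ := by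
  have hc : Fintype.card (Σ c, Fin (γ c)) = Fintype.card (Fin n) := by simp [h]
  let e := Fintype.equivOfCardEq hc
  refine ⟨fun i => (e.symm i).1, ?_⟩
  funext c
  unfold cnt
  rw [← Fintype.card_subtype]
  have e2 : {i // (e.symm i).1 = c} ≃ {x : Σ c, Fin (γ c) // x.1 = c} :=
    e.symm.subtypeEquiv (fun i => Iff.rfl)
  have e3 : {x : Σ c, Fin (γ c) // x.1 = c} ≃ Fin (γ c) :=
    Equiv.sigmaSubtype c
  rw [Fintype.card_congr (e2.trans e3), Fintype.card_fin]

theorem cnt_inj {C : Type} (p q : Fin n → C) (h : cnt p = cnt q) : ∃ σ : Equiv.Perm (Fin n), q ∘ σ = p := by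
  have : ∀ c, Nonempty ({i // p i = c} ≃ {i // q i = c}) := by
    intro c
    rw [← Fintype.card_eq, Fintype.card_subtype, Fintype.card_subtype]
    exact congrFun h c
  let E := fun c => (this c).some
  refine ⟨(Equiv.sigmaFiberEquiv p).symm.trans ((Equiv.sigmaCongrRight E).trans (Equiv.sigmaFiberEquiv q)), ?_⟩
  funext i
  exact (E (p i) ⟨i, rfl⟩).2

theorem burn {C : Type} [Fintype C] (Q : (C → ℕ) → Prop) :
    ∑ σ : Equiv.Perm (Fin n), Nat.card {p : Fin n → C // Q (cnt p) ∧ p ∘ σ = p} =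
      Nat.card {γ : C → ℕ // Q γ ∧ ∑ c, γ c = n} * n.factorial := by
  let _ : MulAction (Equiv.Perm (Fin n)) {p : Fin n → C // Q (cnt p)} :=
    { smul := fun σ p => ⟨p.1 ∘ (σ⁻¹ : Equiv.Perm (Fin n)), by rw [cnt_comp]; exact p.2⟩
      one_smul := fun p => rfl
      mul_smul := fun σ τ p => by
        apply Subtype.ext
        change p.1 ∘ ((σ * τ)⁻¹ : Equiv.Perm (Fin n)) = (p.1 ∘ (τ⁻¹ : Equiv.Perm (Fin n))) ∘ (σ⁻¹ : Equiv.Perm (Fin n))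
        rw [mul_inv_rev]; rfl }
  have hsm : ∀ (σ : Equiv.Perm (Fin n)) (p : {p : Fin n → C // Q (cnt p)}),
    (σ • p).1 = p.1 ∘ (σ⁻¹ : Equiv.Perm (Fin n)) := fun _ _ => rfl
  have hB := MulAction.sum_card_fixedBy_eq_card_orbits_mul_card_group (Equiv.Perm (Fin n))
    {p : Fin n → C // Q (cnt p)}
  rw [Fintype.card_perm, Fintype.card_fin] at hB
  have e1 : ∀ σ : Equiv.Perm (Fin n), Nat.card {p : Fin n → C // Q (cnt p) ∧ p ∘ σ = p} =
      Fintype.card (MulAction.fixedBy {p : Fin n → C // Q (cnt p)} σ) := by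
    intro σ
    rw [← Nat.card_eq_fintype_card]
    refine Nat.card_congr ((Equiv.subtypeSubtypeEquivSubtypeInter _ _).symm.trans
      (Equiv.subtypeEquivRight fun p => ?_))
    rw [MulAction.mem_fixedBy, Subtype.ext_iff, hsm]
    constructor
    · intro h
      conv_lhs => rw [← h]
      funext i; simp
    · intro h
      conv_lhs => rw [← h]
      funext i; simp
  simp_rw [e1]
  rw [hB, ← Nat.card_eq_fintype_card]
  congr 1
  have hwd : ∀ p q : {p : Fin n → C // Q (cnt p)},
      MulAction.orbitRel (Equiv.Perm (Fin n)) _ p q ↔ cnt p.1 = cnt q.1 := by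
    intro p q
    rw [MulAction.orbitRel_apply, MulAction.mem_orbit_iff]
    constructor
    · rintro ⟨σ, rfl⟩
      rw [hsm, cnt_comp]
    · intro h
      obtain ⟨σ, hσ⟩ := cnt_inj _ _ h
      refine ⟨σ⁻¹, Subtype.ext ?_⟩
      rw [hsm, inv_inv, hσ]
  refine Nat.card_congr (Equiv.ofBijective (fun x => Quotient.liftOn x
    (fun p => (⟨cnt p.1, p.2, cnt_sum p.1⟩ : {γ : C → ℕ // Q γ ∧ ∑ c, γ c = n}))
    (fun p q h => Subtype.ext ((hwd p q).1 h))) ⟨?_, ?_⟩)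
  · intro x y
    induction x using Quotient.inductionOn with | _ x => ?_
    induction y using Quotient.inductionOn with | _ y => ?_
    intro h
    exact Quotient.sound ((hwd x y).2 (congrArg Subtype.val h))
  · rintro ⟨γ, h1, h2⟩
    obtain ⟨p, rfl⟩ := cnt_surj γ h2
    exact ⟨Quotient.mk _ ⟨p, h1⟩, rfl⟩

end Burn

section Gram

open scoped Classical

variable {r n : ℕ} [NeZero r] {A B C : Type} [Fintype A] [Fintype B] [Fintype C]
  (colA : A → ZMod r) (colB : B → ZMod r)

theorem stdAddChar_sum {ι : Type*} (s : Finset ι) (x : ι → ZMod r) :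
    (ZMod.stdAddChar (∑ i ∈ s, x i) : ℂ) = ∏ i ∈ s, ZMod.stdAddChar (x i) := by
  induction s using Finset.induction_on with
  | empty => simp
  | insert a s ha ih =>
    rw [Finset.sum_insert ha, Finset.prod_insert ha, AddChar.map_add_eq_mul, ih]

theorem sum_phase (x : Fin n → ZMod r) :
    ∑ f : Fin n → ZMod r, (ZMod.stdAddChar (∑ i, x i * f i) : ℂ) = if x = 0 then (r : ℂ) ^ n else 0 := by
  have h1 : ∀ f : Fin n → ZMod r, (ZMod.stdAddChar (∑ i, x i * f i) : ℂ) =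
      ∏ i, ZMod.stdAddChar (x i * f i) := by
    intro f
    exact stdAddChar_sum _ _
  simp_rw [h1]
  rw [← Fintype.piFinset_univ, ← Finset.prod_univ_sum (fun _ => Finset.univ)
    (fun i t => (ZMod.stdAddChar (x i * t) : ℂ))]
  have h2 : ∀ y : ZMod r, ∑ t, (ZMod.stdAddChar (y * t) : ℂ) = if y = 0 then (r : ℂ) else 0 := by
    intro y
    have := AddChar.sum_mulShift y (ZMod.isPrimitive_stdAddChar r)
    rw [ZMod.card] at this
    push_cast at this
    rw [← this]
    exact Finset.sum_congr rfl fun t _ => by rw [mul_comm]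
  simp_rw [h2]
  by_cases hx : x = 0
  · simp [hx]
  · rw [if_neg hx]
    obtain ⟨i, hi⟩ := Function.ne_iff.1 hx
    exact Finset.prod_eq_zero (Finset.mem_univ i) (if_neg hi)

theorem Mch_inv (β : B → ℕ) (g : WreathProduct r n) : Mch colB β g⁻¹ =
    ∑ u : Fin n → B, if cnt u = β ∧ u ∘ g.right = u then
      (ZMod.stdAddChar (-∑ i, colB (u i) * g.vec i) : ℂ) else 0 := by
  unfold Mch
  refine Finset.sum_congr rfl fun u _ => ?_
  have h1 : u ∘ (g⁻¹).right = u ↔ u ∘ g.right = u := by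
    rw [SemidirectProduct.inv_right]
    constructor
    · intro h
      conv_lhs => rw [← h]
      funext i; simp
    · intro h
      conv_lhs => rw [← h]
      funext i; simp
  simp only [h1]
  by_cases h : cnt u = β ∧ u ∘ g.right = u
  · rw [if_pos h, if_pos h, phase]
    congr 1
    rw [← Finset.sum_neg_distrib]
    conv_rhs => rw [← Equiv.sum_comp g.right]
    refine Finset.sum_congr rfl fun i _ => ?_
    rw [vec_inv]
    have := congrFun h.2 i
    simp only [Function.comp] at this
    rw [this]; ring
  · rw [if_neg h, if_neg h]

variable (c1 : C → A) (c2 : C → B)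

theorem cnt_map {D : Type} (f : C → D) (p : Fin n → C) (d : D) :
    cnt (fun i => f (p i)) d = ∑ c ∈ Finset.univ.filter (fun c => f c = d), cnt p c := by
  unfold cnt
  rw [Finset.card_eq_sum_card_fiberwise (t := Finset.univ.filter (fun c => f c = d)) (f := p)]
  · refine Finset.sum_congr rfl fun c hc => ?_
    congr 1
    ext i
    simp at hc ⊢
    rintro rfl; exact hc
  · intro i hi; simpa using hi

theorem Mch_gram (hinj : ∀ c c', c1 c = c1 c' → c2 c = c2 c' → c = c')
    (hcol : ∀ a b, colA a = colB b ↔ ∃ c, c1 c = a ∧ c2 c = b) (α : A → ℕ) (β : B → ℕ) :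
    fform (Mch (n := n) colA α) (Mch colB β) =
    (Nat.card {γ : C → ℕ // ((∀ a, ∑ c ∈ Finset.univ.filter (fun c => c1 c = a), γ c = α a) ∧
      (∀ b, ∑ c ∈ Finset.univ.filter (fun c => c2 c = b), γ c = β b)) ∧ ∑ c, γ c = n} : ℂ) := by
  have hcard : Nat.card (WreathProduct r n) = r ^ n * n.factorial := by
    rw [SemidirectProduct.card]
    simp [Nat.card_eq_fintype_card, ZMod.card, Fintype.card_perm]
  have hb := burn (n := n) (C := C) (fun γ => (∀ a, ∑ c ∈ Finset.univ.filter (fun c => c1 c = a), γ c = α a) ∧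
      (∀ b, ∑ c ∈ Finset.univ.filter (fun c => c2 c = b), γ c = β b))
  have hmain : ∑ g : WreathProduct r n, Mch colA α g * Mch colB β g⁻¹ = (r : ℂ) ^ n *
      ((∑ σ : Equiv.Perm (Fin n), Nat.card {p : Fin n → C // ((∀ a, ∑ c ∈ Finset.univ.filter (fun c => c1 c = a), cnt p c = α a) ∧
      (∀ b, ∑ c ∈ Finset.univ.filter (fun c => c2 c = b), cnt p c = β b)) ∧ p ∘ σ = p} : ℕ) : ℂ) := by
    let e : (Fin n → ZMod r) × Equiv.Perm (Fin n) ≃ WreathProduct r n :=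
      { toFun := fun p => ⟨fun i => Multiplicative.ofAdd (p.1 i), p.2⟩
        invFun := fun g => (g.vec, g.right)
        left_inv := fun p => rfl
        right_inv := fun g => rfl }
    have he1 : ∀ p, (e p).vec = p.1 := fun _ => rfl
    have he2 : ∀ p, (e p).right = p.2 := fun _ => rfl
    rw [← e.sum_comp, Fintype.sum_prod_type_right]
    push_cast
    rw [Finset.mul_sum]
    refine Finset.sum_congr rfl fun σ _ => ?_
    simp_rw [Mch_inv]
    unfold Mch
    simp_rw [he1, he2, Finset.sum_mul_sum]
    rw [Finset.sum_comm]
    simp_rw [Finset.sum_comm (s := (Finset.univ : Finset (Fin n → ZMod r)))]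
    have h2 : ∀ (w : Fin n → A) (u : Fin n → B), ∑ f : Fin n → ZMod r,
        (if cnt w = α ∧ w ∘ σ = w then phase colA f w else 0) *
        (if cnt u = β ∧ u ∘ σ = u then (ZMod.stdAddChar (-∑ i, colB (u i) * f i) : ℂ) else 0) =
        (r : ℂ) ^ n * if (cnt w = α ∧ w ∘ σ = w) ∧ (cnt u = β ∧ u ∘ σ = u) ∧ (∀ i, colA (w i) = colB (u i)) then 1 else 0 := by
      intro w u
      by_cases hw : cnt w = α ∧ w ∘ σ = w
      · by_cases hu : cnt u = β ∧ u ∘ σ = u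
        · simp only [hw, hu, and_true, if_true, true_and]
          unfold phase
          simp_rw [← AddChar.map_add_eq_mul, ← sub_eq_add_neg, ← Finset.sum_sub_distrib, ← sub_mul]
          rw [sum_phase (fun i => colA (w i) - colB (u i))]
          have : (fun i => colA (w i) - colB (u i)) = 0 ↔ ∀ i, colA (w i) = colB (u i) := by
            rw [funext_iff]; simp [sub_eq_zero]
          simp [this]
        · simp [hu]
      · simp [hw]
    simp_rw [h2, ← Finset.mul_sum]
    congr 1
    rw [← Finset.sum_product', Finset.sum_boole, Nat.cast_inj, Finset.univ_product_univ, ← Fintype.card_subtype,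
      ← Nat.card_eq_fintype_card]
    symm
    refine Nat.card_congr (Equiv.ofBijective (fun p => ⟨(fun i => c1 (p.1 i), fun i => c2 (p.1 i)), ?_⟩) ⟨?_, ?_⟩)
    · obtain ⟨p, ⟨h3, h4⟩, h5⟩ := p
      refine ⟨⟨?_, ?_⟩, ⟨?_, ?_⟩, ?_⟩
      · funext a; rw [← h3]; exact cnt_map c1 p a
      · funext i; exact congrArg c1 (congrFun h5 i)
      · funext a; rw [← h4]; exact cnt_map c2 p a
      · funext i; exact congrArg c2 (congrFun h5 i)
      · intro i; exact (hcol _ _).2 ⟨_, rfl, rfl⟩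
    · intro p q h
      have h := congrArg Subtype.val h
      apply Subtype.ext
      funext i
      exact hinj _ _ (congrFun (congrArg Prod.fst h) i) (congrFun (congrArg Prod.snd h) i)
    · rintro ⟨⟨w, u⟩, ⟨h3, h4⟩, ⟨h5, h6⟩, h7⟩
      have h8 := fun i => (hcol _ _).1 (h7 i)
      choose p hp1 hp2 using h8
      refine ⟨⟨p, ⟨⟨fun a => ?_, fun b => ?_⟩, ?_⟩⟩, ?_⟩
      · rw [← cnt_map]; simp_rw [hp1]; exact congrFun h3 a
      · rw [← cnt_map]; simp_rw [hp2]; exact congrFun h5 b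
      · funext i
        apply hinj
        · have := congrFun h4 i
          simpa [hp1] using this
        · have := congrFun h6 i
          simpa [hp2] using this
      · apply Subtype.ext
        exact Prod.ext (funext hp1) (funext hp2)
  unfold fform
  rw [hmain, hb, hcard]
  have : (r : ℂ) ≠ 0 := by exact_mod_cast NeZero.ne r
  have : (n.factorial : ℂ) ≠ 0 := by exact_mod_cast n.factorial_ne_zero
  push_cast
  field_simp

end Gram

set_option autoImplicit false
set_option linter.unusedSectionVars false

section Trace

open scoped Classical

variable {r n : ℕ}

theorem comp_eq_iff {A : Type} (σ : Equiv.Perm (Fin n)) (w : Fin n → A) :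
    w ∘ σ = w ↔ ∀ i j, σ.SameCycle i j → w i = w j := by
  constructor
  · intro h i j hij
    obtain ⟨m, hm⟩ := hij.exists_nat_pow_eq
    have : ∀ m : ℕ, ∀ i, w ((σ ^ m) i) = w i := by
      intro m
      induction m with
      | zero => simp
      | succ m ih =>
        intro i
        rw [pow_succ, Equiv.Perm.mul_apply, ih]
        exact congrFun h i
    rw [← hm, this]
  · intro h
    funext i
    exact (h i (σ i) ⟨1, by simp⟩).symm

/-- sum over a cycle -/
noncomputable def cycSum (σ : Equiv.Perm (Fin n)) (f : Fin n → ZMod r)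
    (q : Quotient (Equiv.Perm.SameCycle.setoid σ)) : ZMod r :=
  ∑ i ∈ Finset.univ.filter (fun i => (Quotient.mk _ i : Quotient (Equiv.Perm.SameCycle.setoid σ)) = q), f i

theorem mk_eq_iff (σ : Equiv.Perm (Fin n)) (i j : Fin n) :
    ((Quotient.mk _ i : Quotient (Equiv.Perm.SameCycle.setoid σ)) = Quotient.mk _ j) ↔ σ.SameCycle i j :=
  Quotient.eq

theorem cycSum_mk (σ : Equiv.Perm (Fin n)) (f : Fin n → ZMod r) (j : Fin n) :
    cycSum σ f (Quotient.mk _ j) = ∑ i ∈ Finset.univ.filter (fun i => σ.SameCycle j i), f i := by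
  unfold cycSum
  refine Finset.sum_congr ?_ fun _ _ => rfl
  ext i
  simp only [Finset.mem_filter, Finset.mem_univ, true_and]
  rw [mk_eq_iff]
  exact ⟨fun h => h.symm, fun h => h.symm⟩

theorem cycSum_fixed (σ : Equiv.Perm (Fin n)) (f : Fin n → ZMod r) (j : Fin n) (h : σ j = j) :
    cycSum σ f (Quotient.mk _ j) = f j := by
  rw [cycSum_mk, Finset.sum_eq_single j]
  · intro i hi hij
    simp only [Finset.mem_filter, Finset.mem_univ, true_and] at hi
    exact absurd (Equiv.Perm.SameCycle.eq_of_left hi h).symm hij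
  · intro h
    exact absurd (Finset.mem_filter.2 ⟨Finset.mem_univ _, Equiv.Perm.SameCycle.refl _ _⟩) h

theorem cycSum_moved (σ : Equiv.Perm (Fin n)) (f : Fin n → ZMod r) (j : Fin n) (h : σ j ≠ j) :
    cycSum σ f (Quotient.mk _ j) = ∑ i ∈ (σ.cycleOf j).support, f i := by
  rw [cycSum_mk]
  refine Finset.sum_congr ?_ fun _ _ => rfl
  ext i
  simp only [Finset.mem_filter, Finset.mem_univ, true_and]
  rw [Equiv.Perm.mem_support_cycleOf_iff, Equiv.Perm.mem_support]
  exact ⟨fun h' => ⟨h', h⟩, fun h' => h'.1⟩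

theorem fixed_of_same {σ : Equiv.Perm (Fin n)} {i j : Fin n} (h : σ.SameCycle i j) :
    σ i = i ↔ σ j = j := h.apply_eq_self_iff

theorem cycSum_card (σ : Equiv.Perm (Fin n)) (f : Fin n → ZMod r) :
    (Finset.univ.filter (fun q => cycSum σ f q = 0)).card = blockLen r n σ f := by
  unfold blockLen
  rw [← Finset.card_filter_add_card_filter_not (fun q => σ q.out ≠ q.out)]
  congr 1
  · refine Finset.card_bij (fun q _ => σ.cycleOf q.out) ?_ ?_ ?_
    · intro q hq
      simp only [Finset.mem_filter, Finset.mem_univ, true_and] at hq ⊢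
      rw [Equiv.Perm.cycleOf_mem_cycleFactorsFinset_iff, Equiv.Perm.mem_support]
      refine ⟨hq.2, ?_⟩
      rw [← cycSum_moved σ f _ hq.2]
      simpa using hq.1
    · intro q hq q' hq' h
      simp only [Finset.mem_filter, Finset.mem_univ, true_and] at hq hq'
      have h1 : q.out ∈ (σ.cycleOf q.out).support := by
        rw [Equiv.Perm.mem_support_cycleOf_iff, Equiv.Perm.mem_support]
        exact ⟨Equiv.Perm.SameCycle.refl _ _, hq.2⟩
      rw [h, Equiv.Perm.mem_support_cycleOf_iff] at h1
      have := (mk_eq_iff σ _ _).2 h1.1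
      simpa using this.symm
    · intro c hc
      simp only [Finset.mem_filter] at hc
      have hcyc := (Equiv.Perm.mem_cycleFactorsFinset_iff.1 hc.1).1
      obtain ⟨x, hx⟩ := hcyc.nonempty_support
      have hcx := Equiv.Perm.cycle_is_cycleOf hx hc.1
      have hxm : x ∈ σ.support := Equiv.Perm.mem_cycleFactorsFinset_support_le hc.1 hx
      rw [Equiv.Perm.mem_support] at hxm
      have hs : σ.SameCycle x (Quotient.mk (Equiv.Perm.SameCycle.setoid σ) x).out := by
        rw [← mk_eq_iff]; simp
      refine ⟨Quotient.mk _ x, ?_, ?_⟩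
      · simp only [Finset.mem_filter, Finset.mem_univ, true_and]
        rw [cycSum_moved σ f x hxm, ← hcx]
        exact ⟨hc.2, fun h => hxm ((fixed_of_same hs).2 h)⟩
      · rw [hcx]
        exact hs.symm.cycleOf_eq
  · symm
    refine Finset.card_bij (fun i _ => Quotient.mk _ i) ?_ ?_ ?_
    · intro i hi
      simp only [Finset.mem_filter, Finset.mem_univ, true_and, not_not] at hi ⊢
      have hs : σ.SameCycle i (Quotient.mk (Equiv.Perm.SameCycle.setoid σ) i).out := by
        rw [← mk_eq_iff]; simp
      rw [cycSum_fixed σ f i hi.1]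
      exact ⟨hi.2, (fixed_of_same hs).1 hi.1⟩
    · intro i hi j hj h
      simp only [Finset.mem_filter, Finset.mem_univ, true_and] at hi hj
      rw [mk_eq_iff] at h
      exact h.eq_of_left hi.1
    · intro q hq
      simp only [Finset.mem_filter, Finset.mem_univ, true_and, not_not] at hq
      refine ⟨q.out, ?_, by simp⟩
      simp only [Finset.mem_filter, Finset.mem_univ, true_and]
      refine ⟨hq.2, ?_⟩
      rw [← cycSum_fixed σ f _ hq.2]
      simpa using hq.1

variable [NeZero r]

theorem fixed_sum {A : Type} [Fintype A] (col : A → ZMod r) (σ : Equiv.Perm (Fin n)) (f : Fin n → ZMod r) :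
    (∑ w : Fin n → A, if w ∘ σ = w then phase col f w else 0) =
      ∏ q, ∑ a : A, (ZMod.stdAddChar (col a * cycSum σ f q) : ℂ) := by
  rw [← Finset.sum_filter]
  have h1 := Finset.prod_univ_sum (fun _ : Quotient (Equiv.Perm.SameCycle.setoid σ) => (Finset.univ : Finset A))
    (fun q a => (ZMod.stdAddChar (col a * cycSum σ f q) : ℂ))
  rw [h1, Fintype.piFinset_univ]
  symm
  refine Finset.sum_bij (fun v _ => fun i => v (Quotient.mk _ i)) ?_ ?_ ?_ ?_
  · intro v _
    rw [Finset.mem_filter, comp_eq_iff]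
    refine ⟨Finset.mem_univ _, fun i j h => ?_⟩
    exact congrArg v ((mk_eq_iff σ i j).2 h)
  · intro v _ v' _ h
    funext q
    induction q using Quotient.inductionOn with | _ i => exact congrFun h i
  · intro w hw
    rw [Finset.mem_filter, comp_eq_iff] at hw
    exact ⟨fun q => Quotient.liftOn q w hw.2, Finset.mem_univ _, rfl⟩
  · intro v _
    unfold phase
    rw [stdAddChar_sum, ← Finset.prod_fiberwise_of_maps_to (s := Finset.univ) (t := Finset.univ)
      (g := fun i => (Quotient.mk _ i : Quotient (Equiv.Perm.SameCycle.setoid σ))) (by simp)]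
    refine Finset.prod_congr rfl fun q _ => ?_
    rw [cycSum, Finset.mul_sum, stdAddChar_sum]
    refine Finset.prod_congr rfl fun i hi => ?_
    rw [Finset.mem_filter] at hi
    rw [← hi.2]

/-- colors of letters -/
def scol (r : ℕ) (N : Fin r → ℕ) (a : Σ c : Fin r, Fin (N c)) : ZMod r := ((a.1 : ℕ) : ZMod r)

theorem natCast_bij : Function.Bijective (fun c : Fin r => ((c : ℕ) : ZMod r)) := by
  rw [Fintype.bijective_iff_injective_and_card]
  refine ⟨fun c c' h => ?_, by simp [ZMod.card]⟩
  have h2 := (ZMod.natCast_eq_natCast_iff' _ _ _).1 h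
  rw [Nat.mod_eq_of_lt c.2, Nat.mod_eq_of_lt c'.2] at h2
  exact Fin.ext h2

theorem letter_sum (k : ℕ) (y : ZMod r) :
    ∑ a : (Σ c : Fin r, Fin (nvar r k c)), (ZMod.stdAddChar (scol r (nvar r k) a * y) : ℂ) =
      if y = 0 then (r : ℂ) * k + 1 else 1 := by
  rw [Fintype.sum_sigma]
  simp only [scol, Finset.sum_const, Finset.card_univ, Fintype.card_fin]
  have h1 : ∀ c : Fin r, (nvar r k c) • (ZMod.stdAddChar (((c : ℕ) : ZMod r) * y) : ℂ) =
      k * (ZMod.stdAddChar (((c : ℕ) : ZMod r) * y) : ℂ) + if c = (0 : Fin r) then 1 else 0 := by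
    intro c
    have : (c : ℕ) = 0 ↔ c = 0 := by rw [Fin.ext_iff]; simp
    unfold nvar
    by_cases hc : (c : ℕ) = 0
    · rw [if_pos hc, if_pos (this.1 hc)]; simp [hc]
    · rw [if_neg hc, if_neg (fun h => hc (this.2 h))]; simp
  simp_rw [h1]
  rw [Finset.sum_add_distrib, ← Finset.mul_sum]
  have h2 : ∑ c : Fin r, (ZMod.stdAddChar (((c : ℕ) : ZMod r) * y) : ℂ) = if y = 0 then (r : ℂ) else 0 := by
    rw [natCast_bij.sum_comp (fun t : ZMod r => (ZMod.stdAddChar (t * y) : ℂ))]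
    have := AddChar.sum_mulShift y (ZMod.isPrimitive_stdAddChar r)
    rw [ZMod.card] at this
    push_cast at this
    exact this
  rw [h2]
  by_cases hy : y = 0
  · simp [hy]; ring
  · simp [hy]

theorem sum_Mch {A : Type} [Fintype A] (col : A → ZMod r) (S : Finset (A → ℕ))
    (hS : ∀ w : Fin n → A, cnt w ∈ S) (g : WreathProduct r n) :
    ∑ α ∈ S, Mch col α g = ∏ q, ∑ a : A, (ZMod.stdAddChar (col a * cycSum g.right g.vec q) : ℂ) := by
  rw [← fixed_sum]
  unfold Mch
  rw [Finset.sum_comm]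
  refine Finset.sum_congr rfl fun w _ => ?_
  simp_rw [ite_and]
  rw [Finset.sum_ite_eq, if_pos (hS w)]

theorem perm_char (k : ℕ) (S : Finset ((Σ c : Fin r, Fin (nvar r k c)) → ℕ))
    (hS : ∀ w : Fin n → (Σ c : Fin r, Fin (nvar r k c)), cnt w ∈ S) (g : WreathProduct r n) :
    ∑ α ∈ S, Mch (scol r (nvar r k)) α g = ((r : ℂ) * k + 1) ^ g.len := by
  rw [sum_Mch _ S hS]
  simp_rw [letter_sum]
  rw [Finset.prod_ite, Finset.prod_const, Finset.prod_const_one, mul_one, cycSum_card]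
  rfl

end Trace

set_option autoImplicit false
set_option linter.unusedSectionVars false

section Final

open scoped ENNReal Classical

variable {r n : ℕ}

/-- bounding box for partitions -/
noncomputable def bbox (n : ℕ) : Finset (ℕ →₀ ℕ) :=
  Finset.Iic (Finsupp.onFinset (Finset.range n) (fun i => if i < n then n else 0)
    (fun i hi => by rw [Finset.mem_range]; by_contra h; simp [h] at hi))

theorem anti_vanish {l : ℕ →₀ ℕ} (h : ∀ i, l (i + 1) ≤ l i) (hd : l.degree ≤ n) (i : ℕ) (hi : n ≤ i) :
    l i = 0 := by
  by_contra hc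
  have ha : Antitone l := antitone_nat_of_succ_le h
  have h1 : ∑ j ∈ Finset.range (i + 1), 1 ≤ ∑ j ∈ Finset.range (i + 1), l j :=
    Finset.sum_le_sum fun j hj => by
      rw [Finset.mem_range] at hj
      have := ha (show j ≤ i by omega)
      omega
  have h2 : ∑ j ∈ Finset.range (i + 1), l j ≤ l.degree := by
    rw [Finsupp.degree_apply]
    exact Finset.sum_le_sum_of_ne_zero fun j _ hj => Finsupp.mem_support_iff.2 hj
  simp at h1
  omega

theorem mem_bbox {l : ℕ →₀ ℕ} (h : ∀ i, l (i + 1) ≤ l i) (hd : l.degree ≤ n) : l ∈ bbox n := by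
  rw [bbox, Finset.mem_Iic]
  intro i
  rw [Finsupp.onFinset_apply]
  split_ifs with hi
  · exact (Finsupp.le_degree i l).trans hd
  · rw [anti_vanish h hd i (by omega)]

theorem matrix_card {N N' : ℕ} (a : Fin N → ℕ) (b : Fin N' → ℕ) (h : ∑ i, a i ≤ n) :
    Nat.card {g : Fin N' → Fin N → ℕ // (∀ i, ∑ j, g j i = a i) ∧ (∀ j, ∑ i, g j i = b j)} =
      ∑ l ∈ bbox n, KC N a l * KC N' b l := by
  refine (card_of_tsum_ind ?_).2
  refine Eq.trans ?_ (fomin N' a b)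
  rw [tsum_eq_sum (s := bbox n)]
  · push_cast; rfl
  · intro l hl
    by_cases hc : KC N a l = 0
    · simp [hc]
    · exact absurd (mem_bbox (KC_antitone hc) (by rw [KC_degree hc]; exact h)) hl

/-- coefficient -/
noncomputable def KK (Λ : MultiPartition r n) (b : Σ N : Fin r → ℕ, (∀ c, Fin (N c) → ℕ)) : ℕ :=
  ∏ c, KC (b.1 c) (b.2 c) (Λ.fs c)

theorem KK_ne {Λ : MultiPartition r n} {b : Σ N : Fin r → ℕ, (∀ c, Fin (N c) → ℕ)} (h : KK Λ b ≠ 0) (c : Fin r) :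
    KC (b.1 c) (b.2 c) (Λ.fs c) ≠ 0 := Finset.prod_ne_zero_iff.1 h c (Finset.mem_univ c)

theorem KK_sum {Λ : MultiPartition r n} {b : Σ N : Fin r → ℕ, (∀ c, Fin (N c) → ℕ)} (h : KK Λ b ≠ 0) :
    ∑ c, ∑ i, b.2 c i = n := by
  rw [← Λ.sum_degree]
  exact Finset.sum_congr rfl fun c _ => (KC_degree (KK_ne h c)).symm

theorem sum_KK (b b' : Σ N : Fin r → ℕ, (∀ c, Fin (N c) → ℕ)) (h : ∑ c, ∑ i, b.2 c i = n) :
    ∑ Λ : MultiPartition r n, KK Λ b * KK Λ b' =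
      ∏ c, ∑ l ∈ bbox n, KC (b.1 c) (b.2 c) l * KC (b'.1 c) (b'.2 c) l := by
  have h1 := Finset.prod_univ_sum (fun _ : Fin r => bbox n)
    (fun c l => KC (b.1 c) (b.2 c) l * KC (b'.1 c) (b'.2 c) l)
  rw [h1]
  refine Finset.sum_of_injOn (fun Λ => Λ.fs) ?_ ?_ ?_ ?_
  · intro Λ _ Λ' _ hh
    apply MultiPartition.ext'
    intro c a
    exact DFunLike.congr_fun (congrFun hh c) a
  · intro Λ _
    simp only [Finset.mem_coe]
    rw [Fintype.mem_piFinset]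
    exact fun c => mem_bbox (Λ.antitone c) (Λ.degree_le c)
  · intro L hL hne
    by_contra hc
    apply hne
    rw [Finset.prod_mul_distrib] at hc
    have hc1 := fun c => Finset.prod_ne_zero_iff.1 (left_ne_zero_of_mul hc) c (Finset.mem_univ c)
    have hdeg : ∑ c, (L c).degree = n := by
      rw [← h]; exact Finset.sum_congr rfl fun c _ => KC_degree (hc1 c)
    have hle : ∀ c, (L c).degree ≤ n := fun c => by
      conv_rhs => rw [← hdeg]
      exact Finset.single_le_sum (f := fun c => (L c).degree) (fun _ _ => Nat.zero_le _) (Finset.mem_univ c)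
    have hv : ∀ c a, n ≤ a → L c a = 0 := fun c => anti_vanish (KC_antitone (hc1 c)) (hle c)
    refine ⟨⟨fun c a => L c a, fun c => KC_antitone (hc1 c), hv, ?_⟩, by simp, ?_⟩
    · exact Eq.trans (Finset.sum_congr rfl fun c _ => (degree_eq_range (hv c)).symm) hdeg
    · funext c
      ext a
      rfl
  · intro Λ _
    exact Finset.prod_mul_distrib.symm

/-- pairs of letters of the same color -/
abbrev PL (N N' : Fin r → ℕ) := Σ c : Fin r, Fin (N c) × Fin (N' c)

theorem sum_fst {N N' : Fin r → ℕ} (γ : PL N N' → ℕ) (c : Fin r) (i : Fin (N c))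
    [DecidablePred fun x : PL N N' => (⟨x.1, x.2.1⟩ : Σ c, Fin (N c)) = ⟨c, i⟩] :
    ∑ x ∈ Finset.univ.filter (fun x : PL N N' => (⟨x.1, x.2.1⟩ : Σ c, Fin (N c)) = ⟨c, i⟩), γ x =
      ∑ j, γ ⟨c, i, j⟩ := by
  symm
  refine Finset.sum_bij (fun j _ => ⟨c, i, j⟩) ?_ ?_ ?_ ?_
  · intro j _; simp
  · intro j _ j' _ h; simpa using h
  · rintro ⟨c', i', j'⟩ h
    simp only [Finset.mem_filter, Finset.mem_univ, true_and] at h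
    cases h
    exact ⟨j', Finset.mem_univ _, rfl⟩
  · intros; rfl

theorem sum_snd {N N' : Fin r → ℕ} (γ : PL N N' → ℕ) (c : Fin r) (j : Fin (N' c))
    [DecidablePred fun x : PL N N' => (⟨x.1, x.2.2⟩ : Σ c, Fin (N' c)) = ⟨c, j⟩] :
    ∑ x ∈ Finset.univ.filter (fun x : PL N N' => (⟨x.1, x.2.2⟩ : Σ c, Fin (N' c)) = ⟨c, j⟩), γ x =
      ∑ i, γ ⟨c, i, j⟩ := by
  symm
  refine Finset.sum_bij (fun i _ => ⟨c, i, j⟩) ?_ ?_ ?_ ?_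
  · intro j _; simp
  · intro j _ j' _ h; simpa using h
  · rintro ⟨c', i', j'⟩ h
    simp only [Finset.mem_filter, Finset.mem_univ, true_and] at h
    cases h
    exact ⟨i', Finset.mem_univ _, rfl⟩
  · intros; rfl

/-- matrices per color -/
def plEquiv (N N' : Fin r → ℕ) : (PL N N' → ℕ) ≃ (∀ c, Fin (N' c) → Fin (N c) → ℕ) where
  toFun γ c j i := γ ⟨c, i, j⟩
  invFun g x := g x.1 x.2.2 x.2.1
  left_inv _ := rfl
  right_inv _ := rfl

variable [NeZero r]

/-- monomial characters -/
noncomputable def MM (b : Σ N : Fin r → ℕ, (∀ c, Fin (N c) → ℕ)) : WreathProduct r n → ℂ :=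
  Mch (scol r b.1) (fun a => b.2 a.1 a.2)

theorem MM_gram (b b' : Σ N : Fin r → ℕ, (∀ c, Fin (N c) → ℕ)) :
    fform (MM (n := n) b) (MM b') = ((∑ Λ : MultiPartition r n, KK Λ b * KK Λ b' : ℕ) : ℂ) := by
  obtain ⟨N, α⟩ := b
  obtain ⟨N', β⟩ := b'
  unfold MM
  rw [Mch_gram (C := PL N N') (scol r N) (scol r N') (fun x => ⟨x.1, x.2.1⟩) (fun x => ⟨x.1, x.2.2⟩)]
  · congr 1
    by_cases h : ∑ c, ∑ i, α c i = n
    · rw [sum_KK _ _ h]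
      have hle : ∀ c, ∑ i, α c i ≤ n := fun c => by
        conv_rhs => rw [← h]
        exact Finset.single_le_sum (f := fun c => ∑ i, α c i) (fun _ _ => Nat.zero_le _) (Finset.mem_univ c)
      rw [← Finset.prod_congr rfl fun c _ => matrix_card (α c) (β c) (hle c), ← Nat.card_pi]
      refine Nat.card_congr (((plEquiv N N').subtypeEquiv fun γ => ?_).trans Equiv.subtypePiEquivPi)
      simp only [Sigma.forall]
      constructor
      · rintro ⟨⟨h1, h2⟩, h3⟩ c
        refine ⟨fun i => ?_, fun j => ?_⟩
        · rw [← h1 c i]; refine (sum_fst γ c i).symm.trans ?_; congr!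
        · rw [← h2 c j]; refine (sum_snd γ c j).symm.trans ?_; congr!
      · intro hh
        have h1 : ∀ c i, ∑ j, γ ⟨c, i, j⟩ = α c i := fun c i => (hh c).1 i
        refine ⟨⟨fun c i => ?_, fun c j => ?_⟩, ?_⟩
        · rw [← h1 c i]; refine Eq.trans ?_ (sum_fst γ c i); congr!
        · rw [← (hh c).2 j]; refine Eq.trans ?_ (sum_snd γ c j); congr!
        · rw [Fintype.sum_sigma, ← h]
          refine Finset.sum_congr rfl fun c _ => ?_
          rw [Fintype.sum_prod_type]
          exact Finset.sum_congr rfl fun i _ => h1 c i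
    · rw [Finset.sum_eq_zero]
      · rw [Nat.card_eq_zero]
        left
        constructor
        rintro ⟨γ, ⟨h1, h2⟩, h3⟩
        apply h
        rw [← h3, Fintype.sum_sigma]
        refine Finset.sum_congr rfl fun c _ => ?_
        rw [Fintype.sum_prod_type]
        refine Finset.sum_congr rfl fun i _ => ?_
        rw [← sum_fst γ c i]
        refine (h1 ⟨c, i⟩).symm.trans ?_
        congr!
      · intro Λ _
        by_contra hc
        exact h (KK_sum (left_ne_zero_of_mul hc))
  · rintro ⟨c, i, j⟩ ⟨c', i', j'⟩ h1 h2
    cases h1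
    cases h2
    rfl
  · rintro ⟨c, i⟩ ⟨c', j⟩
    constructor
    · intro h
      have : c = c' := natCast_bij.1 h
      subst this
      exact ⟨⟨c, i, j⟩, rfl, rfl⟩
    · rintro ⟨⟨c, i, j⟩, h1, h2⟩
      cases h1
      cases h2
      rfl

/-- weight of a multipartition -/
def mwt (Λ : MultiPartition r n) : Σ N : Fin r → ℕ, (∀ c, Fin (N c) → ℕ) :=
  ⟨fun _ => n, fun c i => Λ.part c i⟩

/-- rank -/
def mrank (Λ : MultiPartition r n) : ℕ :=
  ∑ c, ∑ j ∈ Finset.range (n + 1), (n - ∑ i ∈ Finset.range j, Λ.part c i)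

theorem psum_le (Λ : MultiPartition r n) (c : Fin r) (j : ℕ) (hj : j ≤ n) :
    ∑ i ∈ Finset.range j, Λ.part c i ≤ n := by
  refine le_trans ?_ (Λ.degree_le c)
  rw [Λ.fs_degree]
  exact Finset.sum_le_sum_of_subset (Finset.range_mono hj)

theorem mrank_lt (Λ Λ' : MultiPartition r n) (hne : Λ' ≠ Λ) (h : KK Λ' (mwt Λ) ≠ 0) :
    mrank Λ' < mrank Λ := by
  have hd : ∀ c j, j ≤ n → ∑ i ∈ Finset.range j, Λ.part c i ≤ ∑ i ∈ Finset.range j, Λ'.part c i :=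
    fun c => KC_dom (Λ.part c) (KK_ne h c)
  have hle : ∀ c, ∀ j ∈ Finset.range (n + 1), n - ∑ i ∈ Finset.range j, Λ'.part c i ≤
      n - ∑ i ∈ Finset.range j, Λ.part c i := fun c j hj => by
    rw [Finset.mem_range] at hj
    have := hd c j (by omega)
    omega
  have hle2 : mrank Λ' ≤ mrank Λ := Finset.sum_le_sum fun c _ => Finset.sum_le_sum (hle c)
  refine lt_of_le_of_ne hle2 fun heq => hne ?_
  have h2 := (Finset.sum_eq_sum_iff_of_le (fun c _ => Finset.sum_le_sum (hle c))).1 heq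
  have h3 : ∀ c j, j ≤ n → ∑ i ∈ Finset.range j, Λ'.part c i = ∑ i ∈ Finset.range j, Λ.part c i := by
    intro c j hj
    have h4 := (Finset.sum_eq_sum_iff_of_le (hle c)).1 (h2 c (Finset.mem_univ c)) j
      (Finset.mem_range.2 (by omega))
    have := psum_le Λ c j hj
    have := psum_le Λ' c j hj
    omega
  apply MultiPartition.ext'
  intro c a
  rcases Nat.lt_or_ge a n with ha | ha
  · have h5 := h3 c (a + 1) (by omega)
    have h6 := h3 c a (by omega)
    rw [Finset.sum_range_succ, Finset.sum_range_succ] at h5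
    omega
  · rw [Λ.vanish c a ha, Λ'.vanish c a ha]

theorem KK_diag (Λ : MultiPartition r n) : KK Λ (mwt Λ) = 1 :=
  Finset.prod_eq_one fun c _ => KC_diag (m := Λ.fs c) (Λ.antitone c) (Λ.vanish c)

theorem cnt_le {A : Type} (w : Fin n → A) (a : A) : cnt w a ≤ n := by
  unfold cnt
  exact (Finset.card_le_univ _).trans (by simp)

theorem sum_MM (k : ℕ) (g : WreathProduct r n) :
    ∑ α ∈ Fintype.piFinset (fun c : Fin r =>
      Fintype.piFinset (fun _ : Fin (nvar r k c) => Finset.range (n + 1))),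
      MM ⟨nvar r k, α⟩ g = ((r : ℂ) * k + 1) ^ g.len := by
  rw [← perm_char k ((Fintype.piFinset (fun c : Fin r =>
      Fintype.piFinset (fun _ : Fin (nvar r k c) => Finset.range (n + 1)))).map
      (Equiv.piCurry (fun (c : Fin r) (_ : Fin (nvar r k c)) => ℕ)).symm.toEmbedding)]
  · rw [Finset.sum_map]
    rfl
  · intro w
    rw [Finset.mem_map]
    refine ⟨fun c i => cnt w ⟨c, i⟩, ?_, rfl⟩
    rw [Fintype.mem_piFinset]
    intro c
    rw [Fintype.mem_piFinset]
    intro i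
    rw [Finset.mem_range]
    exact Nat.lt_succ_of_le (cnt_le _ _)

end Final

/-- The Foulkes character `φ^n_k` of `W_{r,n}` decomposes into irreducibles
as `φ^n_k = ∑_{Λ} m_k(Λ) χ^Λ`, the sum being over all `r`-multipartitions of
`n`: there is a family of pairwise distinct irreducible characters `χ^Λ` of
`W_{r,n}` indexed by the `r`-multipartitions of `n` such that for every `k`,
`φ^n_k = ∑_Λ m_k(Λ) · χ^Λ`.  In particular each `φ^n_k` is a genuine
(non-virtual) character. -/
theorem foulkesChar_decomposition (r n : ℕ) (hr : 1 ≤ r) :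
    ∃ X : MultiPartition r n → (WreathProduct r n → ℂ),
      (∀ Λ, ∃ V : FDRep ℂ (WreathProduct r n),
        CategoryTheory.Simple V ∧ X Λ = V.character) ∧
      Function.Injective X ∧
      ∀ k, foulkesChar r n k = ∑ᶠ Λ, (mCount Λ k : ℂ) • X Λ := by
  have : NeZero r := ⟨by omega⟩
  obtain ⟨X, h1, h2, h3⟩ := gram_lemma (G := WreathProduct r n) (I := MultiPartition r n)
    MM (fun b => by
      unfold MM
      rw [← monRep_char]
      exact char_mem_closure _) KK mwt mrank KK_diag
    (fun Λ Λ' hne h => mrank_lt Λ Λ' hne h) MM_gram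
  refine ⟨X, h1, h2, fun k => ?_⟩
  rw [finsum_eq_sum_of_fintype]
  funext g
  have hk : ∀ k : ℕ, ((r : ℂ) * k + 1) ^ g.len = ∑ Λ : MultiPartition r n, (sCount Λ k : ℂ) * X Λ g := by
    intro k
    rw [← sum_MM k g]
    simp_rw [h3, Finset.sum_apply, Pi.smul_apply, smul_eq_mul]
    rw [Finset.sum_comm]
    refine Finset.sum_congr rfl fun Λ _ => ?_
    rw [← Finset.sum_mul, sCount_eq]
    push_cast
    simp [KK]
  unfold foulkesChar
  simp_rw [hk, Finset.sum_apply, Pi.smul_apply, smul_eq_mul, mCount_eq, Finset.mul_sum, Finset.sum_mul]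
  rw [Finset.sum_comm]
  simp_rw [mul_assoc]
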